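/- For a partition λ of n ≥ 1 define τ_λ := (1−q)(t−1) t^{n−1+n(λ)} (Σ_{s∈λ} B_s) · Π_{s∈λ, s≠(1,1)} (1−B_s) / c'_λ(q,t). Then τ satisfies the recursion τ_λ = Σ_{r=1}^{n−1} (−1)^{r−1} t^r Σ_μ τ_μ ψ'_{λ/μ}(q,t) + δ_{λ,(1^n)} (−1)^{n−1}(t^n − 1), where the inner sum is over partitions μ ⊆ λ with |μ| = n−r such that λ/μ is a vertical strip, and δ_{λ,(1^n)} equals 1 if λ is the column partition (1,1,…,1) of n and 0 otherwise. -/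

import Mathlib

noncomputable section
open scoped BigOperators
set_option maxHeartbeats 1000000
set_option synthInstance.maxHeartbeats 400000
attribute [local instance] Classical.propDecidable

/-- The field `F = ℚ(q,t)` of rational functions in two indeterminates. -/
abbrev F : Type := FractionRing (MvPolynomial (Fin 2) ℚ)

/-- The indeterminate `q`. -/
def q : F := algebraMap (MvPolynomial (Fin 2) ℚ) F (MvPolynomial.X 0)

/-- The indeterminate `t`. -/
def t : F := algebraMap (MvPolynomial (Fin 2) ℚ) F (MvPolynomial.X 1)

/-- The row lengths of a partition, `0`-indexed: `rows p i = λ_{i+1}`. -/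
def rows {n : ℕ} (p : Nat.Partition n) : ℕ → ℕ :=
  fun i => ((p.parts.sort (· ≤ ·)).reverse).getD i 0

/-- The Young diagram of a row-length function `r`, as a finset of `0`-indexed boxes
`(i,j)` (`i` the row, `j` the column, so the `1`-indexed coordinates are `(i+1, j+1)`);
`N` is any bound exceeding all row indices and row lengths. -/
def cellsR (N : ℕ) (r : ℕ → ℕ) : Finset (ℕ × ℕ) :=
  (Finset.range N ×ˢ Finset.range N).filter fun s => s.2 < r s.1

/-- The conjugate partition: `conjR N r j` is the length of the `0`-indexed column `j`. -/
def conjR (N : ℕ) (r : ℕ → ℕ) (j : ℕ) : ℕ :=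
  ((Finset.range N).filter fun i => j < r i).card

/-- The arm length `a(s) = λ_i − j` of a (`0`-indexed) box `s`. -/
def armR (r : ℕ → ℕ) (s : ℕ × ℕ) : ℤ := (r s.1 : ℤ) - s.2 - 1

/-- The leg length `l(s) = λ'_j − i` of a (`0`-indexed) box `s`. -/
def legR (N : ℕ) (r : ℕ → ℕ) (s : ℕ × ℕ) : ℤ := (conjR N r s.2 : ℤ) - s.1 - 1

/-- `B_s = q^{j-1} t^{1-i}` for a (`0`-indexed) box `s`. -/
def Bbox (s : ℕ × ℕ) : F := q ^ (s.2 : ℤ) * t ^ (-(s.1 : ℤ))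

/-- The factor `c_λ(s;q,t) = 1 − q^{a(s)} t^{l(s)+1}`. -/
def cArm (N : ℕ) (r : ℕ → ℕ) (s : ℕ × ℕ) : F :=
  1 - q ^ armR r s * t ^ (legR N r s + 1)

/-- The factor `c'_λ(s;q,t) = 1 − q^{a(s)+1} t^{l(s)}`. -/
def cArm' (N : ℕ) (r : ℕ → ℕ) (s : ℕ × ℕ) : F :=
  1 - q ^ (armR r s + 1) * t ^ legR N r s

/-- `c_λ(q,t) = ∏_{s∈λ} (1 − q^{a(s)} t^{l(s)+1})`. -/
def cfun (N : ℕ) (r : ℕ → ℕ) : F := ∏ s ∈ cellsR N r, cArm N r s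

/-- `c'_λ(q,t) = ∏_{s∈λ} (1 − q^{a(s)+1} t^{l(s)})`. -/
def cfun' (N : ℕ) (r : ℕ → ℕ) : F := ∏ s ∈ cellsR N r, cArm' N r s

/-- `b_λ(s;q,t) = c_λ(s)/c'_λ(s)` for `s ∈ λ`, and `1` otherwise. -/
def bval (N : ℕ) (r : ℕ → ℕ) (s : ℕ × ℕ) : F :=
  if s ∈ cellsR N r then cArm N r s / cArm' N r s else 1

/-- `ψ'_{λ/μ}(q,t) = ∏_s b_λ(s)/b_μ(s)`, the product over boxes lying in a column that
meets `λ/μ` but not in a row that meets `λ/μ` (boxes outside `λ` contribute `1`). -/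
def psiP (N : ℕ) (rl rm : ℕ → ℕ) : F :=
  ∏ s ∈ (cellsR N rl).filter (fun s =>
      (∃ i, (i, s.2) ∈ cellsR N rl ∧ (i, s.2) ∉ cellsR N rm) ∧
      ¬ (∃ j, (s.1, j) ∈ cellsR N rl ∧ (s.1, j) ∉ cellsR N rm)),
    bval N rl s / bval N rm s

/-- The Pieri coefficient `d_{λ/μ}(q,t) = ψ'_{λ/μ}(q,t) ⬝ c_μ(q,t)/c'_λ(q,t)`. -/
def dcoef (N : ℕ) (rl rm : ℕ → ℕ) : F := psiP N rl rm * cfun N rm / cfun' N rl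

/-- The Pieri coefficient
`c_{λ/μ}(q,t) = ψ'_{λ/μ}(q,t) ⬝ (c'_λ(q,t)/c'_μ(q,t)) ⬝ (1−t)/(1−q)`. -/
def ccoef (N : ℕ) (rl rm : ℕ → ℕ) : F :=
  psiP N rl rm * (cfun' N rl / cfun' N rm) * ((1 - t) / (1 - q))

/-- `n(λ) = ∑_{s∈λ} (i(s)−1)`. -/
def nstat (N : ℕ) (r : ℕ → ℕ) : ℕ := ∑ s ∈ cellsR N r, s.1

/-- `n(λ') = ∑_{s∈λ} (j(s)−1)`. -/
def nstatC (N : ℕ) (r : ℕ → ℕ) : ℕ := ∑ s ∈ cellsR N r, s.2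

/-- `τ_λ = (1−q)(t−1) t^{|λ|−1+n(λ)} (∑_{s∈λ} B_s) ∏_{s∈λ, s≠(1,1)} (1−B_s) / c'_λ(q,t)`
(the box `(1,1)` is `(0,0)` in `0`-indexed coordinates). -/
def tau {n : ℕ} (l : Nat.Partition n) : F :=
  (1 - q) * (t - 1) * t ^ ((n : ℤ) - 1 + (nstat n (rows l) : ℤ)) *
    (∑ s ∈ cellsR n (rows l), Bbox s) *
    (∏ s ∈ (cellsR n (rows l)).erase ((0, 0) : ℕ × ℕ), (1 - Bbox s)) / cfun' n (rows l)

section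

open Finset

theorem det_row_perturb {K : Type*} [Field K] {n : ℕ} (s : K) (y g : Fin n → K)
    (e : Fin n → ℕ) :
    (Matrix.of fun i k => y i ^ e k * (1 + s ^ e k * g i)).det
      = ∑ I : Finset (Fin n), (∏ i ∈ I, g i) *
          (Matrix.of fun i k => (if i ∈ I then s * y i else y i) ^ e k).det := by
  have h := (Matrix.detRowAlternating (R := K) (n := Fin n)).toMultilinearMap.map_add_univ
    (fun i k => g i * (s * y i) ^ e k) (fun i k => y i ^ e k)
  have h1 : (Matrix.of fun i k => y i ^ e k * (1 + s ^ e k * g i))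
      = (fun i k => g i * (s * y i) ^ e k) + (fun i k => y i ^ e k) := by
    ext i k
    simp only [Matrix.of_apply, Pi.add_apply, mul_pow]
    ring
  rw [h1]
  refine h.trans (Finset.sum_congr rfl fun I _ => ?_)
  have h2 : (I.piecewise (fun i k => g i * (s * y i) ^ e k) (fun i k => y i ^ e k) :
      Fin n → Fin n → K) = fun i => (if i ∈ I then g i else 1) •
        (fun k => (if i ∈ I then s * y i else y i) ^ e k) := by
    ext i k
    by_cases hi : i ∈ I <;> simp [Finset.piecewise, hi]
  rw [h2, MultilinearMap.map_smul_univ, Finset.prod_ite_mem, Finset.univ_inter]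
  rfl

theorem exists_pow_card_eq {K : Type*} [Field K] {M : ℕ} (v : Fin (M + 1) → K) :
    ∃ c : Fin (M + 1) → K, (∀ i, v i ^ (M + 1) = ∑ k, c k * v i ^ (k : ℕ)) ∧
      c (Fin.last M) = ∑ i, v i := by
  set P : Polynomial K := ∏ i, (Polynomial.X - Polynomial.C (v i)) with hP
  have hdeg : P.natDegree = M + 1 := by simp [hP]
  have hmon : P.Monic := Polynomial.monic_prod_X_sub_C _ _
  refine ⟨fun k => -P.coeff k, fun i => ?_, ?_⟩
  · have h0 : P.eval (v i) = 0 := by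
      rw [hP, Polynomial.eval_prod]
      exact Finset.prod_eq_zero (Finset.mem_univ i) (by simp)
    rw [Polynomial.eval_eq_sum_range, hdeg, Finset.sum_range_succ, ← hdeg,
      hmon.coeff_natDegree, hdeg, Finset.sum_range] at h0
    simp only [neg_mul, Finset.sum_neg_distrib]
    linear_combination h0
  · have h := Polynomial.prod_X_sub_C_coeff_card_pred (Finset.univ : Finset (Fin (M + 1))) v
      (by simp)
    simp only [Finset.card_univ, Fintype.card_fin, Nat.add_sub_cancel] at h
    simp only [Fin.val_last]
    rw [hP, h, neg_neg]

theorem det_vandermonde_skip {K : Type*} [Field K] {M : ℕ} (v : Fin (M + 1) → K) :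
    (Matrix.of fun i k : Fin (M + 1) => v i ^ (if k = Fin.last M then M + 1 else (k : ℕ))).det
      = (∑ i, v i) * (Matrix.vandermonde v).det := by
  obtain ⟨c, hc, hl⟩ := exists_pow_card_eq v
  have h := Matrix.det_updateCol_sum (Matrix.vandermonde v) (Fin.last M) c
  rw [← hl, ← smul_eq_mul, ← h]
  congr 1
  ext i k
  by_cases hk : k = Fin.last M
  · subst hk
    simp [hc, Matrix.vandermonde_apply]
  · simp [hk, Matrix.vandermonde_apply]

theorem det_bidiagonal_cols {K : Type*} [Field K] {M : ℕ} (y h u : Fin (M + 1) → K)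
    (a b : ℕ → K) (ha : a 0 = 0) (hu : ∀ i, h i = ∑ m, u m * y i ^ ((m : ℕ) + 1)) :
    (Matrix.of fun i k : Fin (M + 1) => if k = Fin.last M then h i else
        a k * y i ^ (k : ℕ) + b k * y i ^ ((k : ℕ) + 1)).det
      = (∏ k : Fin M, b k) * u (Fin.last M) * ((∏ i, y i) * (Matrix.vandermonde y).det) := by
  set U : Matrix (Fin (M + 1)) (Fin (M + 1)) K := Matrix.of fun m k =>
    if k = Fin.last M then u m else
      if m = k then b k else if (m : ℕ) + 1 = k then a k else 0 with hU
  have hfac : (Matrix.of fun i k : Fin (M + 1) => if k = Fin.last M then h i else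
        a k * y i ^ (k : ℕ) + b k * y i ^ ((k : ℕ) + 1))
      = (Matrix.of fun i k => y i * Matrix.vandermonde y i k) * U := by
    ext i k
    rw [Matrix.mul_apply]
    simp only [hU, Matrix.of_apply, Matrix.vandermonde_apply]
    by_cases hk : k = Fin.last M
    · simp only [hk, if_true, hu]
      exact Finset.sum_congr rfl fun m _ => by ring
    · simp only [hk, if_false]
      obtain ⟨k, hk'⟩ := k
      cases k with
      | zero =>
        rw [Finset.sum_eq_single ⟨0, hk'⟩]
        · simp [ha, mul_comm]
        · intro m _ hm
          have hm' : m ≠ 0 := by simpa using hm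
          simp [hm']
        · simp
      | succ k =>
        have hlt : k < M + 1 := by omega
        have hne : (⟨k, hlt⟩ : Fin (M + 1)) ≠ ⟨k + 1, hk'⟩ := by simp
        rw [← Finset.sum_subset (Finset.subset_univ {⟨k, hlt⟩, ⟨k + 1, hk'⟩}),
          Finset.sum_pair hne]
        · simp
          ring
        · intro m _ hm
          simp only [Finset.mem_insert, Finset.mem_singleton, not_or] at hm
          simp [hm.2]
          intro hh
          exact absurd (Fin.ext hh) hm.1
  have htri : U.BlockTriangular id := by
    intro m k hkm
    simp only [id] at hkm
    have h1 : k ≠ Fin.last M := fun hh => by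
      subst hh
      exact absurd hkm (not_lt.mpr (Fin.le_last m))
    have h2 : m ≠ k := hkm.ne'
    have h3 : ¬ ((m : ℕ) + 1 = k) := by
      have : (k : ℕ) < m := hkm
      omega
    simp [hU, h1, h2, h3]
  rw [hfac, Matrix.det_mul, Matrix.det_mul_column, Matrix.det_of_isUpperTriangular htri,
    Fin.prod_univ_castSucc fun i => U i i]
  simp [hU, Fin.castSucc_ne_last]
  ring

theorem sum_subsets_vandermonde_eq_zero {K : Type*} [Field K] {M : ℕ} (q t : K) (hq : q ≠ 0)
    (hq1 : q ≠ 1) (ht : t ≠ 0) (ht1 : t ≠ 1) (y : Fin (M + 1) → K)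
    (hy : ∀ i, 1 - y i / q ≠ 0) :
    ∑ I : Finset (Fin (M + 1)),
      (∏ i ∈ I, (-((1 - t ^ M * y i) / (1 - y i / q)))) *
        (Matrix.vandermonde fun i => if i ∈ I then t⁻¹ * y i else y i).det *
        (((∑ i, y i) - ∑ i ∈ range (M + 1), (t⁻¹) ^ i) / (q - 1) - (∑ i ∈ I, y i) / q) = 0 := by
  set g : Fin (M + 1) → K := fun i => -((1 - t ^ M * y i) / (1 - y i / q)) with hg
  set V : Finset (Fin (M + 1)) → K := fun I =>
    (Matrix.vandermonde fun i => if i ∈ I then t⁻¹ * y i else y i).det with hV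
  set E : K := ∑ i, y i with hE
  set Pr : K := ∏ i, (1 - y i / q) with hPr
  have hPr0 : Pr ≠ 0 := Finset.prod_ne_zero_iff.mpr fun i _ => hy i
  set b : ℕ → K := fun k => t ^ M * (t⁻¹) ^ k - q⁻¹ with hb
  set a : ℕ → K := fun k => 1 - (t⁻¹) ^ k with ha
  set W : K := (∏ k : Fin M, b k) * ((∏ i, y i) * (Matrix.vandermonde y).det) with hW
  have key : ∀ e : ℕ, ∀ i, (1 - y i / q) * (y i ^ e * (1 + (t⁻¹) ^ e * g i))
      = a e * y i ^ e + b e * y i ^ (e + 1) := by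
    intro e i
    have := hy i
    have h1 : (1 - y i / q) * g i = -(1 - t ^ M * y i) := by
      simp only [hg]
      rw [mul_neg, mul_div_assoc', mul_div_cancel_left₀ _ this]
    calc _ = (1 - y i / q) * y i ^ e + y i ^ e * (t⁻¹) ^ e * ((1 - y i / q) * g i) := by ring
      _ = _ := by
        rw [h1]
        simp only [ha, hb]
        field_simp
        ring
  have S0 : Pr * ∑ I : Finset (Fin (M + 1)), (∏ i ∈ I, g i) * V I = W * (1 - q⁻¹) := by
    have h := det_row_perturb t⁻¹ y g (fun k => (k : ℕ))
    have h' : ∑ I : Finset (Fin (M + 1)), (∏ i ∈ I, g i) * V I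
        = (Matrix.of fun i (k : Fin (M + 1)) =>
            y i ^ (k : ℕ) * (1 + (t⁻¹) ^ (k : ℕ) * g i)).det := by
      rw [h]
      rfl
    rw [h', hPr, ← Matrix.det_mul_column]
    have h2 := det_bidiagonal_cols y (fun i => a M * y i ^ M + b M * y i ^ (M + 1))
      (fun m => if m = Fin.last M then b M else if (m : ℕ) + 1 = M then a M else 0) a b
      (by simp [ha]) (fun i => by
        cases M with
        | zero => simp [ha]
        | succ M =>
          rw [Fin.sum_univ_castSucc, Fin.sum_univ_castSucc]
          have h4 : ∀ x : Fin M, x.castSucc.castSucc ≠ Fin.last (M + 1) := fun x =>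
            Fin.castSucc_ne_last _
          simp [h4, Fin.castSucc_ne_last, (Fin.is_lt _).ne])
    have h5 : b M = 1 - q⁻¹ := by
      simp only [hb]
      rw [← mul_pow, mul_inv_cancel₀ ht, one_pow]
    rw [if_pos rfl, h5] at h2
    rw [hW, mul_right_comm, ← h2]
    congr 1
    ext i k
    simp only [Matrix.of_apply, key]
    by_cases hk : k = Fin.last M
    · simp [hk, h5]
    · simp [hk]
  have S1 : Pr * ∑ I : Finset (Fin (M + 1)), (∏ i ∈ I, g i) *
      ((∑ i, if i ∈ I then t⁻¹ * y i else y i) * V I)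
      = W * ((t⁻¹ - q⁻¹) * E + (1 - (t⁻¹) ^ (M + 1))) := by
    have h := det_row_perturb t⁻¹ y g
      (fun k : Fin (M + 1) => if k = Fin.last M then M + 1 else (k : ℕ))
    simp only [det_vandermonde_skip] at h
    rw [← h, hPr, ← Matrix.det_mul_column]
    obtain ⟨c, hc, hl⟩ := exists_pow_card_eq y
    have h2 := det_bidiagonal_cols y
      (fun i => a (M + 1) * y i ^ (M + 1) + b (M + 1) * y i ^ (M + 2))
      (fun m => b (M + 1) * c m + if m = Fin.last M then a (M + 1) else 0) a b
      (by simp [ha]) (fun i => by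
        simp only [add_mul, Finset.sum_add_distrib, ite_mul, zero_mul, Finset.sum_ite_eq',
          Finset.mem_univ, if_true, Fin.val_last]
        rw [pow_succ (y i) (M + 1), hc, Finset.sum_mul, Finset.mul_sum, Finset.mul_sum,
          add_comm]
        congr 1
        exact Finset.sum_congr rfl fun m _ => by ring)
    have h5 : b (M + 1) = t⁻¹ - q⁻¹ := by
      simp only [hb]
      rw [pow_succ, ← mul_assoc, ← mul_pow, mul_inv_cancel₀ ht, one_pow, one_mul]
    rw [if_pos rfl, h5, hl] at h2
    rw [hW, mul_right_comm, ← h2]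
    congr 1
    ext i k
    simp only [Matrix.of_apply, key]
    by_cases hk : k = Fin.last M
    · simp [hk, h5]
    · simp [hk]
  have ht' : t⁻¹ ≠ 1 := fun h => ht1 (by rw [← inv_inv t, h, inv_one])
  have hgeo : ∑ i ∈ range (M + 1), (t⁻¹) ^ i = ((t⁻¹) ^ (M + 1) - 1) / (t⁻¹ - 1) :=
    geom_sum_eq ht' _
  have hIsum : ∀ I : Finset (Fin (M + 1)),
      (∑ i, if i ∈ I then t⁻¹ * y i else y i) = E + (t⁻¹ - 1) * ∑ i ∈ I, y i := by
    intro I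
    rw [hE, Finset.mul_sum, ← Finset.sum_filter_add_sum_filter_not univ (· ∈ I) (fun i => y i),
      Finset.sum_ite]
    simp only [Finset.filter_mem_eq_inter, Finset.univ_inter]
    rw [← Finset.mul_sum, ← Finset.mul_sum]
    ring
  simp only [hIsum] at S1
  have ht2 : t⁻¹ - 1 ≠ 0 := sub_ne_zero.mpr ht'
  have hq2 : q - 1 ≠ 0 := sub_ne_zero.mpr hq1
  have hterm : ∀ I : Finset (Fin (M + 1)), (∏ i ∈ I, g i) * V I *
      ((E - ∑ i ∈ range (M + 1), (t⁻¹) ^ i) / (q - 1) - (∑ i ∈ I, y i) / q)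
      = ((E - ((t⁻¹) ^ (M + 1) - 1) / (t⁻¹ - 1)) / (q - 1) + E / (q * (t⁻¹ - 1))) *
          ((∏ i ∈ I, g i) * V I)
        - (1 / (q * (t⁻¹ - 1))) * ((∏ i ∈ I, g i) *
          ((E + (t⁻¹ - 1) * ∑ i ∈ I, y i) * V I)) := by
    intro I
    rw [hgeo]
    generalize t⁻¹ = s at *
    have : s - 1 ≠ 0 := ht2
    field_simp
    ring
  rw [Finset.sum_congr rfl fun I _ => hterm I, Finset.sum_sub_distrib, ← Finset.mul_sum,
    ← Finset.mul_sum]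
  apply mul_left_cancel₀ hPr0
  rw [mul_zero, mul_sub, mul_left_comm, S0,
    mul_left_comm Pr (1 / (q * (t⁻¹ - 1))), S1]
  generalize t⁻¹ = s at *
  have : s - 1 ≠ 0 := ht2
  field_simp
  ring

theorem q_ne_zero : q ≠ 0 := by
  simp [q]

theorem t_ne_zero : t ≠ 0 := by
  simp [t]

theorem q_pow_mul_t_pow_inj {a b c d : ℕ} (h : q ^ a * t ^ b = q ^ c * t ^ d) :
    a = c ∧ b = d := by
  have h1 : (MvPolynomial.X 0 ^ a * MvPolynomial.X 1 ^ b : MvPolynomial (Fin 2) ℚ)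
      = MvPolynomial.X 0 ^ c * MvPolynomial.X 1 ^ d := by
    apply IsFractionRing.injective (MvPolynomial (Fin 2) ℚ) F
    simpa [q, t] using h
  rw [MvPolynomial.X_pow_eq_monomial, MvPolynomial.X_pow_eq_monomial,
    MvPolynomial.X_pow_eq_monomial, MvPolynomial.X_pow_eq_monomial,
    MvPolynomial.monomial_mul, MvPolynomial.monomial_mul, mul_one,
    MvPolynomial.monomial_left_inj one_ne_zero] at h1
  have h2 := DFunLike.congr_fun h1 0
  have h3 := DFunLike.congr_fun h1 1
  simp at h2 h3
  exact ⟨h2, h3⟩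

theorem q_zpow_mul_t_zpow_eq_one {a b : ℤ} (h : q ^ a * t ^ b = 1) : a = 0 ∧ b = 0 := by
  have h1 : q ^ a.toNat * t ^ b.toNat = q ^ (-a).toNat * t ^ (-b).toNat := by
    rw [← zpow_natCast, ← zpow_natCast, ← zpow_natCast, ← zpow_natCast]
    have ha : (a.toNat : ℤ) = a + (-a).toNat := by omega
    have hb : (b.toNat : ℤ) = b + (-b).toNat := by omega
    rw [ha, hb, zpow_add₀ q_ne_zero, zpow_add₀ t_ne_zero]
    linear_combination (q ^ ((-a).toNat : ℤ) * t ^ ((-b).toNat : ℤ)) * h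
  have h2 := q_pow_mul_t_pow_inj h1
  omega

/-- The binomial `1 − q^a t^b`. -/
def qtBinom (a b : ℤ) : F := 1 - q ^ a * t ^ b

theorem qtBinom_ne_zero {a b : ℤ} (h : a ≠ 0 ∨ b ≠ 0) : qtBinom a b ≠ 0 := by
  intro h0
  have := q_zpow_mul_t_zpow_eq_one (sub_eq_zero.mp h0).symm
  omega

/-- `(q t^l; q)_m = ∏_{a=1}^{m} (1 − q^a t^l)`. -/
def qtPoch (l : ℤ) (m : ℕ) : F := ∏ a ∈ range m, qtBinom (a + 1) l

theorem qtPoch_ne_zero (l : ℤ) (m : ℕ) : qtPoch l m ≠ 0 :=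
  Finset.prod_ne_zero_iff.mpr fun a _ => qtBinom_ne_zero (by omega)

theorem qtPoch_succ (l : ℤ) (m : ℕ) : qtPoch l (m + 1) = qtPoch l m * qtBinom (m + 1) l :=
  Finset.prod_range_succ _ _

theorem prod_Ico_qtBinom (l : ℤ) {a c : ℕ} :
    ∏ j ∈ Ico a c, qtBinom ((c : ℤ) - j) l = qtPoch l (c - a) := by
  rw [Finset.prod_Ico_eq_prod_range, qtPoch, ← Finset.prod_range_reflect]
  refine Finset.prod_congr rfl fun j hj => ?_
  rw [Finset.mem_range] at hj
  congr 1
  omega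

theorem prod_Ico_qtBinom_mul (l : ℤ) {a b c : ℕ} (hab : a ≤ b) (hbc : b ≤ c) :
    (∏ j ∈ Ico a b, qtBinom ((c : ℤ) - j) l) * qtPoch l (c - b) = qtPoch l (c - a) := by
  rw [← prod_Ico_qtBinom, ← prod_Ico_qtBinom, Finset.prod_Ico_consecutive _ hab hbc]

/-- `r` is the row-length function of a partition with at most `N` rows, all of length at
most `N`. -/
structure IsRows (N : ℕ) (r : ℕ → ℕ) : Prop where
  anti : Antitone r
  le : ∀ i, r i ≤ N
  zero : r N = 0

theorem IsRows.lt {N : ℕ} {r : ℕ → ℕ} (h : IsRows N r) {i j : ℕ} (hj : j < r i) : i < N := by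
  by_contra hi
  have := h.anti (not_lt.mp hi)
  have := h.zero
  omega

theorem IsRows.mono {N N' : ℕ} {r : ℕ → ℕ} (h : IsRows N r) (hN : N ≤ N') : IsRows N' r :=
  ⟨h.anti, fun i => (h.le i).trans hN, Nat.le_zero.mp (h.zero ▸ h.anti hN)⟩

theorem IsRows.mem_cellsR {N : ℕ} {r : ℕ → ℕ} (h : IsRows N r) {s : ℕ × ℕ} :
    s ∈ cellsR N r ↔ s.2 < r s.1 := by
  simp only [cellsR, Finset.mem_filter, Finset.mem_product, Finset.mem_range]
  exact ⟨fun hs => hs.2, fun hs => ⟨⟨h.lt hs, hs.trans_le (h.le _)⟩, hs⟩⟩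

theorem IsRows.prod_cellsR {α : Type*} [CommMonoid α] {N : ℕ} {r : ℕ → ℕ} (h : IsRows N r)
    (g : ℕ × ℕ → α) :
    ∏ s ∈ cellsR N r, g s = ∏ i ∈ range N, ∏ j ∈ range (r i), g (i, j) := by
  rw [Finset.prod_sigma']
  refine Finset.prod_bij' (fun s _ => ⟨s.1, s.2⟩) (fun s _ => (s.1, s.2)) ?_ ?_ ?_ ?_ ?_
  · intro s hs
    rw [h.mem_cellsR] at hs
    simpa using ⟨h.lt hs, hs⟩
  · intro s hs
    rw [h.mem_cellsR]
    simp only [Finset.mem_sigma, Finset.mem_range] at hs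
    exact hs.2
  · intro s _
    rfl
  · intro s _
    rfl
  · intro s _
    rfl

theorem IsRows.sum_cellsR {α : Type*} [AddCommMonoid α] {N : ℕ} {r : ℕ → ℕ} (h : IsRows N r)
    (g : ℕ × ℕ → α) :
    ∑ s ∈ cellsR N r, g s = ∑ i ∈ range N, ∑ j ∈ range (r i), g (i, j) :=
  h.prod_cellsR (α := Multiplicative α) g

theorem IsRows.lt_conjR {N : ℕ} {r : ℕ → ℕ} (h : IsRows N r) {i j : ℕ} :
    i < conjR N r j ↔ j < r i := by
  have hex : ∃ k, r k ≤ j := ⟨N, by rw [h.zero]; exact Nat.zero_le _⟩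
  have key : ∀ k, k < Nat.find hex ↔ j < r k := by
    intro k
    rw [Nat.lt_find_iff]
    exact ⟨fun hk => not_le.mp (hk k le_rfl), fun hk m hm => not_le.mpr (hk.trans_le (h.anti hm))⟩
  have hset : ((Finset.range N).filter fun i => j < r i) = Finset.range (Nat.find hex) := by
    ext k
    simp only [Finset.mem_filter, Finset.mem_range, key]
    exact ⟨fun hk => hk.2, fun hk => ⟨h.lt hk, hk⟩⟩
  rw [conjR, hset, Finset.card_range, key]

theorem IsRows.conjR_eq {N : ℕ} {r : ℕ → ℕ} (h : IsRows N r) {j c : ℕ}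
    (hc : ∀ i, i < c ↔ j < r i) : conjR N r j = c := by
  have h1 := fun i => (h.lt_conjR (i := i) (j := j)).trans (hc i).symm
  have h2 := h1 c
  have h3 := h1 (conjR N r j)
  omega

theorem IsRows.cellsR_mono {N N' : ℕ} {r : ℕ → ℕ} (h : IsRows N r) (hN : N ≤ N') :
    cellsR N r = cellsR N' r := by
  ext s
  rw [h.mem_cellsR, (h.mono hN).mem_cellsR]

theorem IsRows.conjR_mono {N N' : ℕ} {r : ℕ → ℕ} (h : IsRows N r) (hN : N ≤ N') (j : ℕ) :
    conjR N r j = conjR N' r j :=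
  h.conjR_eq fun _ => (h.mono hN).lt_conjR

theorem IsRows.cfun'_mono {N N' : ℕ} {r : ℕ → ℕ} (h : IsRows N r) (hN : N ≤ N') :
    cfun' N r = cfun' N' r := by
  simp only [cfun', cArm', legR, h.cellsR_mono hN, h.conjR_mono hN]

theorem IsRows.prod_row {N : ℕ} {r : ℕ → ℕ} (h : IsRows N r) {i K : ℕ} (hK : i + 1 ≤ K) :
    ∏ j ∈ Ico (r K) (r i), qtBinom ((r i : ℤ) - j) ((conjR N r j : ℤ) - i - 1)
      = qtPoch ((K : ℤ) - 1 - i) (r i - r K) * ∏ k ∈ Ico (i + 1) K,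
          qtPoch ((k : ℤ) - i - 1) (r i - r k) / qtPoch ((k : ℤ) - i) (r i - r k) := by
  have hblock : ∀ k, ∏ j ∈ Ico (r (k + 1)) (r k),
      qtBinom ((r i : ℤ) - j) ((conjR N r j : ℤ) - i - 1)
      = ∏ j ∈ Ico (r (k + 1)) (r k), qtBinom ((r i : ℤ) - j) ((k : ℤ) - i) := by
    intro k
    refine Finset.prod_congr rfl fun j hj => ?_
    rw [Finset.mem_Ico] at hj
    have hc : conjR N r j = k + 1 := h.conjR_eq fun m => by
      constructor
      · intro hm
        exact hj.2.trans_le (h.anti (Nat.lt_succ_iff.mp hm))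
      · intro hm
        by_contra hmk
        have := h.anti (not_lt.mp hmk)
        omega
    rw [hc]
    congr 1
    push_cast
    ring
  induction K, hK using Nat.le_induction with
  | base =>
    rw [hblock, Finset.Ico_self, Finset.prod_empty, mul_one, prod_Ico_qtBinom]
    congr 1
    push_cast
    ring
  | succ K hK ih =>
    have h1 : r (K + 1) ≤ r K := h.anti (Nat.le_succ K)
    have h2 : r K ≤ r i := h.anti (by omega)
    rw [← Finset.prod_Ico_consecutive _ h1 h2, ih, hblock, Finset.prod_Ico_succ_top hK]
    have h3 := prod_Ico_qtBinom_mul ((K : ℤ) - i) h1 h2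
    have h4 : (((K + 1 : ℕ) : ℤ) - 1 - i) = (K : ℤ) - i := by
      push_cast
      ring
    have h5 : (K : ℤ) - 1 - i = (K : ℤ) - i - 1 := by ring
    rw [h4, h5, ← h3]
    have := qtPoch_ne_zero ((K : ℤ) - i) (r i - r K)
    field_simp

theorem IsRows.cfun'_eq {N : ℕ} {r : ℕ → ℕ} (h : IsRows N r) :
    cfun' N r = ∏ i ∈ range N, (qtPoch ((N : ℤ) - 1 - i) (r i) * ∏ k ∈ Ico (i + 1) N,
          qtPoch ((k : ℤ) - i - 1) (r i - r k) / qtPoch ((k : ℤ) - i) (r i - r k)) := by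
  rw [cfun', h.prod_cellsR]
  refine Finset.prod_congr rfl fun i hi => ?_
  have h1 := h.prod_row (i := i) (K := N) (Finset.mem_range.mp hi)
  rw [h.zero, Nat.Ico_zero_eq_range, Nat.sub_zero] at h1
  rw [← h1]
  refine Finset.prod_congr rfl fun j _ => ?_
  simp only [cArm', armR, legR, qtBinom]
  congr 3
  ring

theorem IsRows.cfun'_ne_zero {N : ℕ} {r : ℕ → ℕ} (h : IsRows N r) : cfun' N r ≠ 0 := by
  rw [h.cfun'_eq]
  exact Finset.prod_ne_zero_iff.mpr fun i _ => mul_ne_zero (qtPoch_ne_zero _ _)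
    (Finset.prod_ne_zero_iff.mpr fun k _ => div_ne_zero (qtPoch_ne_zero _ _) (qtPoch_ne_zero _ _))

/-- `λ/μ` is a vertical strip, for partitions given by their row-length functions. -/
structure IsVStrip (N : ℕ) (lam mu : ℕ → ℕ) : Prop where
  outer : IsRows N lam
  inner : IsRows N mu
  le : ∀ i, mu i ≤ lam i
  le_succ : ∀ i, lam i ≤ mu i + 1

/-- `c_λ(s)/c'_λ(s)` for a box `s` with arm length `a` and leg length `l`. -/
def bRatio (a l : ℤ) : F := qtBinom a (l + 1) / qtBinom (a + 1) l

theorem bRatio_ne_zero {a l : ℤ} (ha : 0 ≤ a) (h : a ≠ 0 ∨ l ≠ -1) :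
    bRatio a l ≠ 0 :=
  div_ne_zero (qtBinom_ne_zero (by omega)) (qtBinom_ne_zero (by omega))

theorem prod_Ico_div_of_ne_zero {K : Type*} [Field K] (f : ℕ → K) {a b : ℕ} (hab : a ≤ b)
    (hf : ∀ k, a ≤ k → f k ≠ 0) : ∏ k ∈ Ico a b, f (k + 1) / f k = f b / f a := by
  induction b, hab using Nat.le_induction with
  | base => simp [hf a le_rfl]
  | succ b hab ih =>
    have h1 := hf a le_rfl
    have h2 := hf b hab
    rw [Finset.prod_Ico_succ_top hab, ih]
    field_simp

theorem IsRows.bval_eq {N : ℕ} {r : ℕ → ℕ} (h : IsRows N r) {i j : ℕ} (hj : j < r i) :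
    bval N r (i, j) = bRatio ((r i : ℤ) - j - 1) ((conjR N r j : ℤ) - i - 1) := by
  rw [bval, if_pos (h.mem_cellsR.mpr hj)]
  rfl

theorem IsVStrip.psiP_eq_prod_cellsR {N : ℕ} {lam mu : ℕ → ℕ} (h : IsVStrip N lam mu) :
    psiP N lam mu = ∏ s ∈ cellsR N lam,
      if mu s.1 = lam s.1 then bval N lam s / bval N mu s else 1 := by
  have hl := h.outer
  have hm := h.inner
  rw [psiP, Finset.prod_filter]
  refine Finset.prod_congr rfl fun s hs => ?_
  obtain ⟨i, j⟩ := s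
  rw [hl.mem_cellsR] at hs
  simp only [hl.mem_cellsR, hm.mem_cellsR] at hs ⊢
  have hrow : (¬ ∃ j, j < lam i ∧ ¬ j < mu i) ↔ mu i = lam i := by
    have := h.le i
    constructor
    · intro hn
      by_contra hne
      exact hn ⟨mu i, by omega, by omega⟩
    · rintro he ⟨j, h1, h2⟩
      omega
  simp only [hrow]
  by_cases he : mu i = lam i
  · by_cases hc : ∃ k, j < lam k ∧ ¬ j < mu k
    · rw [if_pos ⟨hc, he⟩, if_pos he]
    · rw [if_neg (fun hh => hc hh.1), if_pos he]
      have hconj : conjR N mu j = conjR N lam j := hm.conjR_eq fun k => by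
        rw [hl.lt_conjR]
        have := h.le k
        constructor
        · intro hk
          by_contra hk'
          exact hc ⟨k, hk, hk'⟩
        · intro hk
          omega
      have hi := hl.lt_conjR.mpr hs
      rw [hl.bval_eq hs, hm.bval_eq (he ▸ hs), hconj, he, div_self]
      exact bRatio_ne_zero (by omega) (by omega)
  · rw [if_neg (fun hh => he hh.2), if_neg he]

theorem IsVStrip.psiP_eq {N : ℕ} {lam mu : ℕ → ℕ} (h : IsVStrip N lam mu) :
    psiP N lam mu = ∏ i ∈ range N, ∏ k ∈ Ico (i + 1) N,
      if mu i = lam i ∧ mu k ≠ lam k then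
        bRatio ((lam i : ℤ) - lam k) ((k : ℤ) - i) / bRatio ((lam i : ℤ) - lam k) ((k : ℤ) - i - 1)
      else 1 := by
  have hl := h.outer
  have hm := h.inner
  rw [h.psiP_eq_prod_cellsR, hl.prod_cellsR]
  refine Finset.prod_congr rfl fun i hi => ?_
  by_cases he : mu i = lam i
  swap
  · simp [he]
  simp only [he, if_true, true_and]
  have step2 : ∀ j ∈ range (lam i), bval N lam (i, j) / bval N mu (i, j)
      = ∏ k ∈ Ico (i + 1) N, if lam k = j + 1 ∧ mu k ≠ lam k then
        bRatio ((lam i : ℤ) - lam k) ((k : ℤ) - i) / bRatio ((lam i : ℤ) - lam k) ((k : ℤ) - i - 1)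
      else 1 := by
    intro j hj
    rw [Finset.mem_range] at hj
    have hi1 : i < conjR N lam j := hl.lt_conjR.mpr hj
    have hi2 : i < conjR N mu j := hm.lt_conjR.mpr (he ▸ hj)
    have hle : conjR N mu j ≤ conjR N lam j := by
      by_contra hlt
      have h1 := hm.lt_conjR.mp (not_le.mp hlt)
      have h2 := hl.lt_conjR.mpr (h1.trans_le (h.le _))
      exact lt_irrefl _ h2
    rw [hl.bval_eq hj, hm.bval_eq (he ▸ hj), he]
    rw [← prod_Ico_div_of_ne_zero
      (fun k => bRatio ((lam i : ℤ) - j - 1) ((k : ℤ) - i - 1)) hle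
      (fun k hk => bRatio_ne_zero (by omega) (by omega))]
    rw [← Finset.prod_filter]
    have hset : ((Ico (i + 1) N).filter fun k => lam k = j + 1 ∧ mu k ≠ lam k)
        = Ico (conjR N mu j) (conjR N lam j) := by
      ext k
      have h1 := hl.lt_conjR (i := k) (j := j)
      have h2 := hm.lt_conjR (i := k) (j := j)
      have h3 := h.le k
      have h4 := h.le_succ k
      simp only [Finset.mem_filter, Finset.mem_Ico]
      constructor
      · rintro ⟨-, h5, h6⟩
        constructor
        · by_contra h7
          have := h2.mp (not_le.mp h7)
          omega
        · exact h1.mpr (by omega)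
      · rintro ⟨h5, h6⟩
        have h7 := h1.mp h6
        have h8 : ¬ j < mu k := fun h9 => absurd (h2.mpr h9) (by omega)
        exact ⟨⟨by omega, hl.lt h7⟩, by omega, by omega⟩
    rw [hset]
    refine Finset.prod_congr rfl fun k hk => ?_
    rw [← hset, Finset.mem_filter] at hk
    rw [hk.2.1]
    congr 2
    all_goals
      push_cast
      ring
  rw [Finset.prod_congr rfl step2, Finset.prod_comm]
  refine Finset.prod_congr rfl fun k hk => ?_
  rw [Finset.mem_Ico] at hk
  have h1 : lam k ≤ lam i := hl.anti (by omega)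
  have h2 := h.le k
  by_cases hk' : mu k = lam k
  · simp [hk']
  · rw [if_pos hk', Finset.prod_eq_single (lam k - 1)]
    · rw [if_pos ⟨by omega, hk'⟩]
    · intro j _ hj
      rw [if_neg]
      rintro ⟨h3, -⟩
      omega
    · intro h3
      exact absurd (Finset.mem_range.mpr (by omega)) h3

/-- The content variable `q^{λ_i} t^{-i}` of the `i`-th row. -/
def rowVar (r : ℕ → ℕ) (i : ℕ) : F := q ^ (r i : ℤ) * t ^ (-(i : ℤ))

/-- The content variable of the `i`-th row of `λ`, divided by `t` if the row meets `λ/μ`. -/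
def stripVar (lam mu : ℕ → ℕ) (i : ℕ) : F :=
  if mu i ≠ lam i then t⁻¹ * rowVar lam i else rowVar lam i

theorem rowVar_ne_zero (r : ℕ → ℕ) (i : ℕ) : rowVar r i ≠ 0 :=
  mul_ne_zero (zpow_ne_zero _ q_ne_zero) (zpow_ne_zero _ t_ne_zero)

theorem rowVar_eq_mul (r : ℕ → ℕ) (i k : ℕ) :
    rowVar r i = rowVar r k * (q ^ ((r i : ℤ) - r k) * t ^ ((k : ℤ) - i)) := by
  rw [rowVar, rowVar, mul_mul_mul_comm, ← zpow_add₀ q_ne_zero, ← zpow_add₀ t_ne_zero]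
  congr 2 <;> ring

theorem rowVar_sub (r : ℕ → ℕ) (i k : ℕ) :
    rowVar r k - rowVar r i = rowVar r k * qtBinom ((r i : ℤ) - r k) ((k : ℤ) - i) := by
  rw [rowVar_eq_mul r i k, qtBinom]
  ring

theorem rowVar_sub_ne_zero (r : ℕ → ℕ) {i k : ℕ} (h : i ≠ k) : rowVar r k - rowVar r i ≠ 0 := by
  rw [rowVar_sub]
  exact mul_ne_zero (rowVar_ne_zero _ _) (qtBinom_ne_zero (by omega))

theorem IsVStrip.pair_eq {N : ℕ} {lam mu : ℕ → ℕ} (h : IsVStrip N lam mu) {i k : ℕ}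
    (hik : i < k) :
    (qtPoch ((k : ℤ) - i - 1) (lam i - lam k) / qtPoch ((k : ℤ) - i) (lam i - lam k)) /
      (qtPoch ((k : ℤ) - i - 1) (mu i - mu k) / qtPoch ((k : ℤ) - i) (mu i - mu k)) *
      (if mu i = lam i ∧ mu k ≠ lam k then
        bRatio ((lam i : ℤ) - lam k) ((k : ℤ) - i) / bRatio ((lam i : ℤ) - lam k) ((k : ℤ) - i - 1)
      else 1)
    = (stripVar lam mu k - stripVar lam mu i) / (rowVar lam k - rowVar lam i) *
      (if mu k ≠ lam k then t else 1) := by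
  have hd := rowVar_sub_ne_zero lam hik.ne
  have ht := t_ne_zero
  have hi1 := h.le i
  have hi2 := h.le_succ i
  have hk1 := h.le k
  have hk2 := h.le_succ k
  have hl : lam k ≤ lam i := h.outer.anti hik.le
  have hm : mu k ≤ mu i := h.inner.anti hik.le
  have hy := rowVar_ne_zero lam k
  have hP1 := fun m => qtPoch_ne_zero ((k : ℤ) - i - 1) m
  have hP2 := fun m => qtPoch_ne_zero ((k : ℤ) - i) m
  set l : ℤ := (k : ℤ) - i with hldef
  have hl1 : 1 ≤ l := by omega
  by_cases hi : mu i = lam i <;> by_cases hk : mu k = lam k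
  · simp [hi, hk, stripVar, hd, hP1, hP2]
  · have hdd : mu i - mu k = (lam i - lam k) + 1 := by omega
    have hcast : ((lam i - lam k : ℕ) : ℤ) = (lam i : ℤ) - lam k := by omega
    have hs1 : stripVar lam mu k = t⁻¹ * rowVar lam k := if_pos hk
    have hs2 : stripVar lam mu i = rowVar lam i := if_neg (not_not.mpr hi)
    rw [if_pos ⟨hi, hk⟩, if_pos hk, hdd, qtPoch_succ, qtPoch_succ, hcast, hs1, hs2, rowVar_sub,
      rowVar_eq_mul lam i k, ← hldef]
    have hnum : t⁻¹ * rowVar lam k - rowVar lam k * (q ^ ((lam i : ℤ) - lam k) * t ^ l)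
        = rowVar lam k * t⁻¹ * qtBinom ((lam i : ℤ) - lam k) (l + 1) := by
      rw [qtBinom, zpow_add_one₀ ht]
      field_simp
    rw [hnum, bRatio, bRatio, sub_add_cancel]
    set a : ℤ := (lam i : ℤ) - lam k
    have b1 : qtBinom a l ≠ 0 := qtBinom_ne_zero (by omega)
    have b2 : qtBinom (a + 1) l ≠ 0 := qtBinom_ne_zero (by omega)
    have b3 : qtBinom (a + 1) (l - 1) ≠ 0 := qtBinom_ne_zero (by omega)
    have p1 := hP1 (lam i - lam k)
    have p2 := hP2 (lam i - lam k)
    field_simp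
  · have hdd : lam i - lam k = (mu i - mu k) + 1 := by omega
    have hcast : ((mu i - mu k : ℕ) : ℤ) + 1 = (lam i : ℤ) - lam k := by omega
    have hs1 : stripVar lam mu k = rowVar lam k := if_neg (not_not.mpr hk)
    have hs2 : stripVar lam mu i = t⁻¹ * rowVar lam i := if_pos hi
    rw [if_neg (fun hh => hi hh.1), if_neg (not_not.mpr hk), hdd, qtPoch_succ, qtPoch_succ, hcast,
      hs1, hs2, rowVar_sub, rowVar_eq_mul lam i k, ← hldef]
    have hnum : rowVar lam k - t⁻¹ * (rowVar lam k * (q ^ ((lam i : ℤ) - lam k) * t ^ l))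
        = rowVar lam k * qtBinom ((lam i : ℤ) - lam k) (l - 1) := by
      rw [qtBinom, zpow_sub_one₀ ht]
      field_simp
    rw [hnum]
    set a : ℤ := (lam i : ℤ) - lam k
    have b1 : qtBinom a l ≠ 0 := qtBinom_ne_zero (by omega)
    have p1 := hP1 (mu i - mu k)
    have p2 := hP2 (mu i - mu k)
    field_simp
  · have hdd : mu i - mu k = lam i - lam k := by omega
    have hs1 : stripVar lam mu k = t⁻¹ * rowVar lam k := if_pos hk
    have hs2 : stripVar lam mu i = t⁻¹ * rowVar lam i := if_pos hi
    rw [if_neg (fun hh => hi hh.1), if_pos hk, hdd, hs1, hs2, ← mul_sub, div_self, mul_div_assoc,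
      div_self hd, one_mul, mul_one, inv_mul_cancel₀ ht]
    exact div_ne_zero (hP1 _) (hP2 _)

theorem IsVStrip.prod_cellsR {α : Type*} [CommMonoid α] {N : ℕ} {lam mu : ℕ → ℕ}
    (h : IsVStrip N lam mu) (g : ℕ × ℕ → α) :
    ∏ s ∈ cellsR N lam, g s = (∏ s ∈ cellsR N mu, g s) *
      ∏ i ∈ range N, if mu i ≠ lam i then g (i, mu i) else 1 := by
  rw [h.outer.prod_cellsR, h.inner.prod_cellsR, ← Finset.prod_mul_distrib]
  refine Finset.prod_congr rfl fun i _ => ?_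
  have h1 := h.le i
  have h2 := h.le_succ i
  by_cases hi : mu i = lam i
  · simp [hi]
  · have h3 : lam i = mu i + 1 := by omega
    rw [if_pos hi, h3, Finset.prod_range_succ]

theorem IsVStrip.sum_cellsR {α : Type*} [AddCommMonoid α] {N : ℕ} {lam mu : ℕ → ℕ}
    (h : IsVStrip N lam mu) (g : ℕ × ℕ → α) :
    ∑ s ∈ cellsR N lam, g s = (∑ s ∈ cellsR N mu, g s) +
      ∑ i ∈ range N, if mu i ≠ lam i then g (i, mu i) else 0 :=
  h.prod_cellsR (α := Multiplicative α) g

theorem prod_range_prod_Ico {α : Type*} [CommMonoid α] (N : ℕ) (g : ℕ → α) :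
    ∏ i ∈ range N, ∏ k ∈ Ico (i + 1) N, g k = ∏ k ∈ range N, g k ^ k := by
  rw [Finset.prod_comm' (t' := range N) (s' := fun k => range k)]
  · simp
  · intro i k
    simp only [Finset.mem_range, Finset.mem_Ico]
    omega

theorem det_vandermonde_eq_prod_range {K : Type*} [CommRing K] (N : ℕ) (v : ℕ → K) :
    (Matrix.vandermonde fun i : Fin N => v i).det
      = ∏ i ∈ range N, ∏ k ∈ Ico (i + 1) N, (v k - v i) := by
  rw [Matrix.det_vandermonde, Finset.prod_range]
  refine Finset.prod_congr rfl fun i _ => ?_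
  have h : Ico ((i : ℕ) + 1) N = (Finset.Ioi i).map Fin.valEmbedding := by
    rw [Fin.map_valEmbedding_Ioi]
    ext k
    simp only [Finset.mem_Ico, Finset.mem_Ioo]
    omega
  rw [h, Finset.prod_map]
  rfl

theorem det_vandermonde_rowVar_ne_zero (N : ℕ) (r : ℕ → ℕ) :
    (Matrix.vandermonde fun i : Fin N => rowVar r i).det ≠ 0 := by
  rw [Matrix.det_vandermonde_ne_zero_iff]
  intro i k hik
  by_contra hne
  exact rowVar_sub_ne_zero r (fun h => hne (Fin.ext h)) (sub_eq_zero.mpr hik.symm)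

theorem IsVStrip.t_pow_nstat {N : ℕ} {lam mu : ℕ → ℕ} (h : IsVStrip N lam mu) :
    t ^ nstat N lam = t ^ nstat N mu * ∏ k ∈ range N, (if mu k ≠ lam k then t else 1) ^ k := by
  rw [nstat, nstat, h.sum_cellsR, pow_add, ← Finset.prod_pow_eq_pow_sum]
  congr 1
  rw [← Finset.prod_pow_eq_pow_sum]
  refine Finset.prod_congr rfl fun k _ => ?_
  split_ifs <;> simp

theorem IsVStrip.qtPoch_div {N : ℕ} {lam mu : ℕ → ℕ} (h : IsVStrip N lam mu) (i : ℕ) :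
    qtPoch ((N : ℤ) - 1 - i) (lam i) / qtPoch ((N : ℤ) - 1 - i) (mu i)
      = if mu i ≠ lam i then 1 - t ^ ((N : ℤ) - 1) * rowVar lam i else 1 := by
  have h1 := h.le i
  have h2 := h.le_succ i
  by_cases hi : mu i = lam i
  · simp [hi, qtPoch_ne_zero]
  · have h3 : lam i = mu i + 1 := by omega
    rw [if_pos hi, h3, qtPoch_succ, mul_div_cancel_left₀ _ (qtPoch_ne_zero _ _), qtBinom, rowVar,
      h3, mul_left_comm, ← zpow_add₀ t_ne_zero]
    congr 3

theorem IsVStrip.psiP_mul_det {N : ℕ} {lam mu : ℕ → ℕ} (h : IsVStrip N lam mu) :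
    psiP N lam mu * t ^ nstat N mu / cfun' N mu *
        (Matrix.vandermonde fun i : Fin N => rowVar lam i).det
      = t ^ nstat N lam / cfun' N lam *
        (∏ i ∈ range N, if mu i ≠ lam i then 1 - t ^ ((N : ℤ) - 1) * rowVar lam i else 1) *
        (Matrix.vandermonde fun i : Fin N => stripVar lam mu i).det := by
  have hdet := det_vandermonde_rowVar_ne_zero N lam
  have hcl := h.outer.cfun'_ne_zero
  have hcm := h.inner.cfun'_ne_zero
  have key : cfun' N lam / cfun' N mu * psiP N lam mu
      = (∏ i ∈ range N, if mu i ≠ lam i then 1 - t ^ ((N : ℤ) - 1) * rowVar lam i else 1) *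
        ((Matrix.vandermonde fun i : Fin N => stripVar lam mu i).det /
          (Matrix.vandermonde fun i : Fin N => rowVar lam i).det *
          ∏ k ∈ range N, (if mu k ≠ lam k then t else 1) ^ k) := by
    rw [h.outer.cfun'_eq, h.inner.cfun'_eq, h.psiP_eq, ← Finset.prod_div_distrib,
      ← Finset.prod_mul_distrib, det_vandermonde_eq_prod_range,
      det_vandermonde_eq_prod_range N (rowVar lam), ← prod_range_prod_Ico,
      ← Finset.prod_div_distrib, ← Finset.prod_mul_distrib, ← Finset.prod_mul_distrib]
    refine Finset.prod_congr rfl fun i _ => ?_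
    rw [← h.qtPoch_div i, mul_div_mul_comm, mul_assoc, ← Finset.prod_div_distrib,
      ← Finset.prod_div_distrib, ← Finset.prod_mul_distrib, ← Finset.prod_mul_distrib]
    congr 1
    refine Finset.prod_congr rfl fun k hk => ?_
    exact h.pair_eq (Finset.mem_Ico.mp hk).1
  rw [h.t_pow_nstat]
  rw [div_mul_eq_mul_div, div_eq_iff hcm] at key
  rw [div_mul_eq_mul_div, div_mul_eq_mul_div, div_mul_eq_mul_div, div_eq_div_iff hcm hcl]
  calc _ = (cfun' N lam * psiP N lam mu) * t ^ nstat N mu *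
        (Matrix.vandermonde fun i : Fin N => rowVar lam i).det := by ring
    _ = _ := by
      rw [key]
      field_simp

theorem q_ne_one : q ≠ 1 := fun h => by
  have := q_zpow_mul_t_zpow_eq_one (a := 1) (b := 0) (by simp [h])
  omega

theorem t_ne_one : t ≠ 1 := fun h => by
  have := q_zpow_mul_t_zpow_eq_one (a := 0) (b := 1) (by simp [h])
  omega

theorem IsRows.sum_Bbox {N : ℕ} {r : ℕ → ℕ} (h : IsRows N r) :
    ∑ s ∈ cellsR N r, Bbox s
      = (∑ i ∈ range N, rowVar r i - ∑ i ∈ range N, t⁻¹ ^ i) / (q - 1) := by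
  rw [h.sum_cellsR, ← Finset.sum_sub_distrib, Finset.sum_div]
  refine Finset.sum_congr rfl fun i _ => ?_
  simp only [Bbox, rowVar, zpow_natCast]
  rw [← Finset.sum_mul, geom_sum_eq q_ne_one, zpow_neg, zpow_natCast, inv_pow]
  ring

theorem IsVStrip.Bbox_eq {N : ℕ} {lam mu : ℕ → ℕ} (h : IsVStrip N lam mu) {i : ℕ}
    (hi : mu i ≠ lam i) : Bbox (i, mu i) = rowVar lam i / q := by
  have h1 := h.le i
  have h2 := h.le_succ i
  have h3 : lam i = mu i + 1 := by omega
  rw [Bbox, rowVar, h3, Nat.cast_succ, zpow_add_one₀ q_ne_zero]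
  have := q_ne_zero
  field_simp

theorem IsVStrip.sum_Bbox {N : ℕ} {lam mu : ℕ → ℕ} (h : IsVStrip N lam mu) :
    ∑ s ∈ cellsR N mu, Bbox s = ∑ s ∈ cellsR N lam, Bbox s -
      ∑ i ∈ range N, if mu i ≠ lam i then rowVar lam i / q else 0 := by
  rw [h.sum_cellsR, add_sub_assoc, ← Finset.sum_sub_distrib]
  refine (add_eq_left.mpr (Finset.sum_eq_zero fun i _ => ?_)).symm
  by_cases hi : mu i = lam i
  · simp [hi]
  · simp [hi, h.Bbox_eq hi]

theorem prod_erase_eq {α β : Type*} [DecidableEq α] [CommMonoid β] (s : Finset α) (a : α)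
    (g : α → β) : ∏ x ∈ s.erase a, g x = ∏ x ∈ s, if x = a then 1 else g x := by
  by_cases ha : a ∈ s
  · rw [← Finset.mul_prod_erase s _ ha, if_pos rfl, one_mul]
    exact Finset.prod_congr rfl fun x hx => (if_neg (Finset.ne_of_mem_erase hx)).symm
  · rw [Finset.erase_eq_of_notMem ha]
    exact Finset.prod_congr rfl fun x hx => (if_neg (ne_of_mem_of_not_mem hx ha)).symm

theorem IsVStrip.prod_one_sub_Bbox {N : ℕ} {lam mu : ℕ → ℕ} (h : IsVStrip N lam mu)
    (h0 : mu 0 ≠ 0) :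
    ∏ s ∈ (cellsR N lam).erase (0, 0), (1 - Bbox s)
      = (∏ s ∈ (cellsR N mu).erase (0, 0), (1 - Bbox s)) *
        ∏ i ∈ range N, if mu i ≠ lam i then 1 - rowVar lam i / q else 1 := by
  rw [prod_erase_eq, prod_erase_eq, h.prod_cellsR]
  congr 1
  refine Finset.prod_congr rfl fun i _ => ?_
  by_cases hi : mu i = lam i
  · simp [hi]
  · rw [if_pos hi, if_pos hi, if_neg, h.Bbox_eq hi]
    intro h1
    rw [Prod.mk.injEq] at h1
    exact h0 (h1.1 ▸ h1.2)

theorem one_sub_rowVar_div_ne_zero {r : ℕ → ℕ} {i : ℕ} (h : i ≠ 0 ∨ r i ≠ 1) :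
    1 - rowVar r i / q ≠ 0 := by
  have h1 : 1 - rowVar r i / q = qtBinom ((r i : ℤ) - 1) (-(i : ℤ)) := by
    rw [qtBinom, rowVar, zpow_sub_one₀ q_ne_zero]
    ring
  rw [h1]
  exact qtBinom_ne_zero (by omega)

/-- The expression for `τ_λ` in terms of the row lengths and the size of `λ`. -/
def tauR (N : ℕ) (m : ℤ) (r : ℕ → ℕ) : F :=
  (1 - q) * (t - 1) * t ^ (m - 1 + (nstat N r : ℤ)) * (∑ s ∈ cellsR N r, Bbox s) *
    (∏ s ∈ (cellsR N r).erase ((0, 0) : ℕ × ℕ), (1 - Bbox s)) / cfun' N r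

theorem IsRows.tauR_mono {N N' : ℕ} {r : ℕ → ℕ} (h : IsRows N r) (hN : N ≤ N') (m : ℤ) :
    tauR N m r = tauR N' m r := by
  simp only [tauR, nstat, h.cellsR_mono hN, h.cfun'_mono hN]

theorem IsVStrip.tauR_mul_psiP {M : ℕ} {lam mu : ℕ → ℕ} (h : IsVStrip (M + 1) lam mu)
    (h0 : 2 ≤ lam 0) (n : ℤ) (I : Finset (Fin (M + 1)))
    (hI : ∀ i : Fin (M + 1), i ∈ I ↔ mu i ≠ lam i) :
    (-1) ^ #I * t ^ #I * (tauR (M + 1) (n - #I) mu * psiP (M + 1) lam mu)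
      = (1 - q) * (t - 1) * t ^ (n - 1) * (t ^ nstat (M + 1) lam / cfun' (M + 1) lam) *
        (∏ s ∈ (cellsR (M + 1) lam).erase (0, 0), (1 - Bbox s)) /
        (Matrix.vandermonde fun i : Fin (M + 1) => rowVar lam i).det *
      ((∏ i ∈ I, (-((1 - t ^ M * rowVar lam i) / (1 - rowVar lam i / q)))) *
        (Matrix.vandermonde fun i : Fin (M + 1) =>
          if i ∈ I then t⁻¹ * rowVar lam i else rowVar lam i).det *
        (((∑ i : Fin (M + 1), rowVar lam i) - ∑ i ∈ range (M + 1), (t⁻¹) ^ i) / (q - 1) -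
          (∑ i ∈ I, rowVar lam i) / q)) := by
  have hsub : ∀ {α : Type} [CommMonoid α] (g : ℕ → α),
      (∏ i ∈ range (M + 1), if mu i ≠ lam i then g i else 1) = ∏ i ∈ I, g i := by
    intro α _ g
    rw [Finset.prod_range, ← Finset.prod_filter]
    refine Finset.prod_congr ?_ fun _ _ => rfl
    ext i
    simp [hI]
  have hsubs : (∑ i ∈ range (M + 1), if mu i ≠ lam i then rowVar lam i / q else 0)
      = (∑ i ∈ I, rowVar lam i) / q := by
    rw [Finset.sum_div]
    exact hsub (α := Multiplicative F) fun i => rowVar lam i / q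
  have hmu0 : mu 0 ≠ 0 := by
    have := h.le_succ 0
    omega
  have hstrip : (fun i : Fin (M + 1) => if i ∈ I then t⁻¹ * rowVar lam i else rowVar lam i)
      = fun i : Fin (M + 1) => stripVar lam mu i := by
    ext i
    simp only [stripVar, hI]
  have hB : ((∑ i : Fin (M + 1), rowVar lam i) - ∑ i ∈ range (M + 1), (t⁻¹) ^ i) / (q - 1) -
      (∑ i ∈ I, rowVar lam i) / q = ∑ s ∈ cellsR (M + 1) mu, Bbox s := by
    rw [h.sum_Bbox, h.outer.sum_Bbox, hsubs, Finset.sum_range (fun i => rowVar lam i)]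
  have hpsi := h.psiP_mul_det
  rw [hsub] at hpsi
  have hM : ((M + 1 : ℕ) : ℤ) - 1 = M := by
    push_cast
    ring
  rw [hM, zpow_natCast] at hpsi
  have hden : (∏ i ∈ I, (1 - rowVar lam i / q)) ≠ 0 :=
    Finset.prod_ne_zero_iff.mpr fun i _ => one_sub_rowVar_div_ne_zero (by
      by_cases hi : (i : ℕ) = 0
      · right
        rw [hi]
        omega
      · exact Or.inl hi)
  have hdet := det_vandermonde_rowVar_ne_zero (M + 1) lam
  rw [hstrip, hB, h.prod_one_sub_Bbox hmu0, hsub, Finset.prod_neg, Finset.prod_div_distrib, tauR]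
  have hpow : t ^ #I * t ^ (n - #I - 1 + (nstat (M + 1) mu : ℤ))
      = t ^ (n - 1) * t ^ nstat (M + 1) mu := by
    rw [← zpow_natCast, ← zpow_natCast, ← zpow_add₀ t_ne_zero, ← zpow_add₀ t_ne_zero]
    congr 1
    ring
  set V := (Matrix.vandermonde fun i : Fin (M + 1) => rowVar lam i).det with hV
  set V' := (Matrix.vandermonde fun i : Fin (M + 1) => stripVar lam mu i).det with hV'
  set A := ∏ i ∈ I, (1 - rowVar lam i / q) with hA
  set A' := ∏ i ∈ I, (1 - t ^ M * rowVar lam i) with hA'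
  set Z := ∏ s ∈ (cellsR (M + 1) mu).erase (0, 0), (1 - Bbox s) with hZ
  set S := ∑ s ∈ cellsR (M + 1) mu, Bbox s with hS
  have hcl := h.outer.cfun'_ne_zero
  have hcm := h.inner.cfun'_ne_zero
  calc _ = (-1) ^ #I * (1 - q) * (t - 1) *
        (t ^ #I * t ^ (n - #I - 1 + (nstat (M + 1) mu : ℤ))) * S * Z *
        (psiP (M + 1) lam mu / cfun' (M + 1) mu) := by ring
    _ = (-1) ^ #I * (1 - q) * (t - 1) * t ^ (n - 1) * S * Z *
        (psiP (M + 1) lam mu * t ^ nstat (M + 1) mu / cfun' (M + 1) mu * V) / V := by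
      rw [hpow]
      field_simp
    _ = _ := by
      rw [hpsi]
      field_simp

theorem sum_range_getD (L : List ℕ) {N : ℕ} (hN : L.length ≤ N) :
    ∑ i ∈ range N, L.getD i 0 = L.sum := by
  induction L generalizing N with
  | nil => simp
  | cons a L ih =>
    obtain ⟨N, rfl⟩ : ∃ K, N = K + 1 := ⟨N - 1, by simp at hN; omega⟩
    rw [Finset.sum_range_succ', List.sum_cons, add_comm]
    simp only [List.getD_cons_succ, List.getD_cons_zero]
    rw [ih (by simpa using hN)]

theorem getD_ne_zero_iff {L : List ℕ} (hL : ∀ x ∈ L, 0 < x) {i : ℕ} :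
    L.getD i 0 ≠ 0 ↔ i < L.length := by
  constructor
  · intro h
    by_contra hi
    exact h (List.getD_eq_default _ _ (not_lt.mp hi))
  · intro h
    rw [List.getD_eq_getElem _ _ h]
    exact (hL _ (List.getElem_mem h)).ne'

/-- The parts of a partition in decreasing order. -/
def decParts {n : ℕ} (p : Nat.Partition n) : List ℕ := (p.parts.sort (· ≤ ·)).reverse

theorem coe_decParts {n : ℕ} (p : Nat.Partition n) : (decParts p : Multiset ℕ) = p.parts := by
  rw [decParts, Multiset.coe_reverse, Multiset.sort_eq]

theorem pairwise_decParts {n : ℕ} (p : Nat.Partition n) : (decParts p).Pairwise (· ≥ ·) :=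
  List.pairwise_reverse.mpr (Multiset.pairwise_sort _ _)

theorem mem_decParts {n : ℕ} {p : Nat.Partition n} {x : ℕ} : x ∈ decParts p ↔ x ∈ p.parts := by
  rw [← coe_decParts, Multiset.mem_coe]

theorem pos_of_mem_decParts {n : ℕ} (p : Nat.Partition n) : ∀ x ∈ decParts p, 0 < x :=
  fun _ hx => p.parts_pos (mem_decParts.mp hx)

theorem sum_decParts {n : ℕ} (p : Nat.Partition n) : (decParts p).sum = n := by
  rw [← Multiset.sum_coe, coe_decParts, p.parts_sum]

theorem length_decParts_le {n : ℕ} (p : Nat.Partition n) : (decParts p).length ≤ n := by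
  have := List.length_le_sum_of_one_le (decParts p) (pos_of_mem_decParts p)
  rwa [sum_decParts] at this

theorem rows_eq_getD {n : ℕ} (p : Nat.Partition n) (i : ℕ) : rows p i = (decParts p).getD i 0 :=
  rfl

theorem rows_ne_zero_iff {n : ℕ} {p : Nat.Partition n} {i : ℕ} :
    rows p i ≠ 0 ↔ i < (decParts p).length :=
  getD_ne_zero_iff (pos_of_mem_decParts p)

theorem isRows_rows {n : ℕ} (p : Nat.Partition n) : IsRows n (rows p) where
  anti := by
    intro i j hij
    simp only [rows_eq_getD]
    by_cases hj : j < (decParts p).length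
    · rw [List.getD_eq_getElem _ _ hj, List.getD_eq_getElem _ _ (hij.trans_lt hj)]
      exact (pairwise_decParts p).rel_get_of_le (a := ⟨i, hij.trans_lt hj⟩) (b := ⟨j, hj⟩) hij
    · rw [List.getD_eq_default _ _ (not_lt.mp hj)]
      exact Nat.zero_le _
  le i := by
    by_cases hi : i < (decParts p).length
    · rw [rows_eq_getD, List.getD_eq_getElem _ _ hi]
      exact Nat.Partition.le_of_mem_parts (mem_decParts.mp (List.getElem_mem hi))
    · rw [rows_eq_getD, List.getD_eq_default _ _ (not_lt.mp hi)]
      exact Nat.zero_le _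
  zero := List.getD_eq_default _ _ (length_decParts_le p)

theorem sum_rows {n N : ℕ} (p : Nat.Partition n) (hN : n ≤ N) : ∑ i ∈ range N, rows p i = n :=
  (sum_range_getD _ ((length_decParts_le p).trans hN)).trans (sum_decParts p)

theorem rows_injective {n : ℕ} : Function.Injective (rows : Nat.Partition n → ℕ → ℕ) := by
  intro p p' h
  have hlen : (decParts p).length = (decParts p').length := by
    have h1 := fun i => rows_ne_zero_iff (p := p) (i := i)
    have h2 := fun i => rows_ne_zero_iff (p := p') (i := i)
    rw [h] at h1
    have h3 := fun i => (h1 i).symm.trans (h2 i)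
    have h4 := h3 (decParts p).length
    have h5 := h3 (decParts p').length
    omega
  apply Nat.Partition.ext
  rw [← coe_decParts, ← coe_decParts]
  congr 1
  refine List.ext_getElem hlen fun i h1 h2 => ?_
  have := congrFun h i
  rwa [rows_eq_getD, rows_eq_getD, List.getD_eq_getElem _ _ h1, List.getD_eq_getElem _ _ h2] at this

theorem IsRows.exists_partition {N m : ℕ} {r : ℕ → ℕ} (h : IsRows N r)
    (hm : ∑ i ∈ range N, r i = m) : ∃ p : Nat.Partition m, rows p = r := by
  have hex : ∃ k, r k = 0 := ⟨N, h.zero⟩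
  set c := Nat.find hex with hc
  have hcN : c ≤ N := Nat.find_min' hex h.zero
  have hzero : ∀ i, c ≤ i → r i = 0 := fun i hi =>
    Nat.le_zero.mp ((h.anti hi).trans (Nat.find_spec hex).le)
  set L : List ℕ := (List.range c).map r with hL
  have hgetD : ∀ i, L.getD i 0 = r i := by
    intro i
    by_cases hi : i < c
    · rw [List.getD_eq_getElem _ _ (by simpa [hL] using hi)]
      simp [hL]
    · rw [List.getD_eq_default _ _ (by simpa [hL] using hi), hzero i (not_lt.mp hi)]
  have hsum : L.sum = m := by
    rw [← hm, ← sum_range_getD L (N := N) (by simpa [hL] using hcN)]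
    exact Finset.sum_congr rfl fun i _ => hgetD i
  have hpos : ∀ x ∈ L, 0 < x := by
    intro x hx
    obtain ⟨i, hi, rfl⟩ := List.mem_map.mp hx
    exact Nat.pos_of_ne_zero (Nat.find_min hex (List.mem_range.mp hi))
  have hpair : L.Pairwise (· ≥ ·) := by
    rw [hL, List.pairwise_map]
    exact List.pairwise_lt_range.imp fun hab => h.anti hab.le
  refine ⟨⟨(L : Multiset ℕ), fun hi => hpos _ hi, by rw [Multiset.sum_coe, hsum]⟩, ?_⟩
  funext i
  rw [rows_eq_getD, ← hgetD]
  congr 1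
  refine List.Perm.eq_of_pairwise (le := (· ≥ ·)) (fun a b _ _ hab hba => le_antisymm hba hab)
    (pairwise_decParts _) hpair ?_
  rw [← Multiset.coe_eq_coe, coe_decParts]

theorem parts_eq_replicate_iff {n : ℕ} {p : Nat.Partition n} :
    p.parts = Multiset.replicate n 1 ↔ rows p 0 ≤ 1 := by
  constructor
  · intro h
    by_cases h0 : 0 < (decParts p).length
    · rw [rows_eq_getD, List.getD_eq_getElem _ _ h0]
      have := mem_decParts.mp (List.getElem_mem h0)
      rw [h] at this
      exact (Multiset.eq_of_mem_replicate this).le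
    · rw [rows_eq_getD, List.getD_eq_default _ _ (not_lt.mp h0)]
      exact Nat.zero_le _
  · intro h
    have h1 : ∀ x ∈ p.parts, x = 1 := by
      intro x hx
      have hpos := p.parts_pos hx
      obtain ⟨i, hi, rfl⟩ := List.mem_iff_getElem.mp (mem_decParts.mpr hx)
      have := (isRows_rows p).anti (Nat.zero_le i)
      rw [rows_eq_getD, List.getD_eq_getElem _ _ hi] at this
      omega
    have h2 := Multiset.eq_replicate_of_mem h1
    have h3 := p.parts_sum
    rw [h2, Multiset.sum_replicate, smul_eq_mul, mul_one] at h3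
    rw [h2, h3]

theorem IsVStrip.sum_eq {N : ℕ} {lam mu : ℕ → ℕ} (h : IsVStrip N lam mu) {I : Finset (Fin N)}
    (hI : ∀ i : Fin N, i ∈ I ↔ mu i ≠ lam i) :
    ∑ i ∈ range N, lam i = ∑ i ∈ range N, mu i + #I := by
  have hcard : #I = ∑ i ∈ range N, if mu i ≠ lam i then 1 else 0 := by
    rw [Finset.sum_range, Finset.card_eq_sum_ones, ← Finset.sum_filter]
    refine Finset.sum_congr ?_ fun _ _ => rfl
    ext i
    simp [hI]
  rw [hcard, ← Finset.sum_add_distrib]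
  refine Finset.sum_congr rfl fun i _ => ?_
  have h1 := h.le i
  have h2 := h.le_succ i
  split_ifs <;> omega

theorem IsVStrip.eq_sub {N : ℕ} {lam mu : ℕ → ℕ} (h : IsVStrip N lam mu) {I : Finset (Fin N)}
    (hI : ∀ i : Fin N, i ∈ I ↔ mu i ≠ lam i) (i : Fin N) :
    mu i = lam i - if i ∈ I then 1 else 0 := by
  have h1 := h.le i
  have h2 := h.le_succ i
  have h3 := hI i
  split_ifs with hi
  · have := h3.mp hi
    omega
  · have := mt h3.mpr hi
    omega

/-- Removing one box from each row in `I` yields a vertical strip as soon as the Vandermonde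
determinant of the shifted variables and the boundary factors do not vanish. -/
theorem IsRows.exists_isVStrip {M : ℕ} {lam : ℕ → ℕ} (h : IsRows (M + 1) lam)
    (I : Finset (Fin (M + 1)))
    (hbd : ∀ i ∈ I, 1 - t ^ M * rowVar lam i ≠ 0)
    (hdet : (Matrix.vandermonde fun i : Fin (M + 1) =>
      if i ∈ I then t⁻¹ * rowVar lam i else rowVar lam i).det ≠ 0) :
    ∃ mu, IsVStrip (M + 1) lam mu ∧ ∀ i : Fin (M + 1), i ∈ I ↔ mu i ≠ lam i := by
  rw [Matrix.det_vandermonde_ne_zero_iff] at hdet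
  have hstep : ∀ k (hk : k + 1 < M + 1), lam (k + 1) = lam k → (⟨k, by omega⟩ : Fin (M + 1)) ∈ I →
      (⟨k + 1, hk⟩ : Fin (M + 1)) ∈ I := by
    intro k hk he hkI
    by_contra hkI'
    have := @hdet ⟨k, by omega⟩ ⟨k + 1, hk⟩ (by
      simp only [hkI, hkI', if_true, if_false, rowVar, he]
      rw [Nat.cast_succ, neg_add, zpow_add₀ t_ne_zero, zpow_neg_one]
      ring)
    simp at this
  have hpos : ∀ i (hi : i < M + 1), (⟨i, hi⟩ : Fin (M + 1)) ∈ I → lam i ≠ 0 := by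
    intro i hi hiI h0
    have hprop : ∀ k, i ≤ k → ∀ hk : k < M + 1, (⟨k, hk⟩ : Fin (M + 1)) ∈ I := by
      intro k hik
      induction k, hik using Nat.le_induction with
      | base => exact fun _ => hiI
      | succ k hik ih =>
        intro hk
        have h1 := h.anti hik
        have h2 : lam (k + 1) ≤ lam k := h.anti (Nat.le_succ k)
        exact hstep k hk (by omega) (ih (by omega))
    have hM := hprop M (by omega) (by omega)
    refine hbd _ hM ?_
    have h1 : lam M = 0 := Nat.le_zero.mp (h0 ▸ h.anti (by omega : i ≤ M))
    have := t_ne_zero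
    simp only [rowVar, h1, Nat.cast_zero, zpow_zero, one_mul, zpow_neg, zpow_natCast]
    field_simp
    ring
  set mu : ℕ → ℕ := fun i =>
    lam i - if ∃ hi : i < M + 1, (⟨i, hi⟩ : Fin (M + 1)) ∈ I then 1 else 0 with hmu
  have hle : ∀ i, mu i ≤ lam i := fun i => Nat.sub_le _ _
  refine ⟨mu, ⟨h, ⟨antitone_nat_of_succ_le fun k => ?_, fun i => (hle i).trans (h.le i),
    Nat.le_zero.mp (h.zero ▸ hle _)⟩, hle, fun i => ?_⟩, fun i => ?_⟩
  · have h1 := h.anti (Nat.le_succ k)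
    simp only [hmu, Nat.succ_eq_add_one] at h1 ⊢
    by_cases hk : ∃ hi : k < M + 1, (⟨k, hi⟩ : Fin (M + 1)) ∈ I
    · rw [if_pos hk]
      obtain ⟨hk1, hk2⟩ := hk
      by_cases he : lam (k + 1) = lam k
      · have hlt : k + 1 < M + 1 := by
          by_contra hge
          have h2 : k = M := by omega
          have h3 := hpos k hk1 hk2
          rw [← he, h2, h.zero] at h3
          exact h3 rfl
        rw [if_pos ⟨hlt, hstep k hlt he hk2⟩, he]
      · omega
    · rw [if_neg hk]
      omega
  · simp only [hmu]
    split_ifs <;> omega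
  · have h1 := hpos i i.2
    have h2 : (∃ hi : (i : ℕ) < M + 1, (⟨i, hi⟩ : Fin (M + 1)) ∈ I) ↔ i ∈ I :=
      ⟨fun hi => hi.2, fun hi => ⟨i.2, hi⟩⟩
    simp only [hmu, h2]
    split_ifs with hi
    · have := h1 hi
      simp only [hi, true_iff]
      omega
    · simp [hi]

theorem IsRows.psiP_self {N : ℕ} {r : ℕ → ℕ} (h : IsRows N r) : psiP N r r = 1 := by
  have h1 : IsVStrip N r r := ⟨h, h, fun _ => le_rfl, fun _ => Nat.le_succ _⟩
  rw [h1.psiP_eq]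
  simp

theorem sum_vStrips_eq {M r : ℕ} (l : Nat.Partition (M + 1)) (hr : r ≤ M + 1)
    (A : Finset (Fin (M + 1)) → F)
    (hA : ∀ mu (I : Finset (Fin (M + 1))), IsVStrip (M + 1) (rows l) mu →
      (∀ i : Fin (M + 1), i ∈ I ↔ mu i ≠ rows l i) →
      (-1) ^ #I * t ^ #I * (tauR (M + 1) (((M + 1 : ℕ) : ℤ) - #I) mu * psiP (M + 1) (rows l) mu)
        = A I)
    (hA0 : ∀ I, A I ≠ 0 → ∃ mu, IsVStrip (M + 1) (rows l) mu ∧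
      ∀ i : Fin (M + 1), i ∈ I ↔ mu i ≠ rows l i) :
    (-1) ^ r * t ^ r * ∑ μ : Nat.Partition (M + 1 - r),
      (if (∀ i, rows μ i ≤ rows l i) ∧ (∀ i, rows l i ≤ rows μ i + 1) then
        tau μ * psiP (M + 1) (rows l) (rows μ) else 0)
      = ∑ I ∈ powersetCard r univ, A I := by
  have hl := isRows_rows l
  have hstrip : ∀ μ : Nat.Partition (M + 1 - r),
      (∀ i, rows μ i ≤ rows l i) ∧ (∀ i, rows l i ≤ rows μ i + 1) →
      IsVStrip (M + 1) (rows l) (rows μ) := fun μ hμ =>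
    ⟨hl, (isRows_rows μ).mono (Nat.sub_le _ _), hμ.1, hμ.2⟩
  have hmem : ∀ (μ : Nat.Partition (M + 1 - r)) (i : Fin (M + 1)),
      i ∈ (univ.filter fun i : Fin (M + 1) => rows μ i ≠ rows l i) ↔ rows μ i ≠ rows l i := by
    intro μ i
    simp
  have hcard : ∀ μ : Nat.Partition (M + 1 - r),
      (∀ i, rows μ i ≤ rows l i) ∧ (∀ i, rows l i ≤ rows μ i + 1) →
      #(univ.filter fun i : Fin (M + 1) => rows μ i ≠ rows l i) = r := by
    intro μ hμ
    have h1 := (hstrip μ hμ).sum_eq (hmem μ)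
    rw [sum_rows l le_rfl, sum_rows μ (Nat.sub_le _ _)] at h1
    omega
  rw [← Finset.sum_filter, Finset.mul_sum]
  refine Finset.sum_of_injOn (fun μ => univ.filter fun i : Fin (M + 1) => rows μ i ≠ rows l i)
    ?_ ?_ ?_ ?_
  · intro μ hμ ν hν he
    simp only [Finset.coe_filter, Finset.mem_univ, true_and, Set.mem_ofPred_eq] at hμ hν
    apply rows_injective
    funext i
    by_cases hi : i < M + 1
    · have h1 := (hstrip μ hμ).eq_sub (hmem μ) ⟨i, hi⟩
      have h2 := (hstrip ν hν).eq_sub (hmem ν) ⟨i, hi⟩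
      simp only at he
      rw [he] at h1
      exact h1.trans h2.symm
    · have h1 := (hl.anti (not_lt.mp hi)).trans hl.zero.le
      exact (Nat.le_zero.mp ((hμ.1 i).trans h1)).trans (Nat.le_zero.mp ((hν.1 i).trans h1)).symm
  · intro μ hμ
    simp only [Finset.coe_filter, Finset.mem_univ, true_and, Set.mem_ofPred_eq] at hμ
    exact Finset.mem_coe.mpr (Finset.mem_powersetCard.mpr ⟨Finset.subset_univ _, hcard μ hμ⟩)
  · intro I hI hnot
    by_contra hne
    obtain ⟨mu, h1, h2⟩ := hA0 I hne
    have h3 := h1.sum_eq h2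
    rw [sum_rows l le_rfl, (Finset.mem_powersetCard.mp hI).2] at h3
    obtain ⟨μ, rfl⟩ := h1.inner.exists_partition (m := M + 1 - r) (by omega)
    refine hnot ⟨μ, ?_, ?_⟩
    · simp only [Finset.coe_filter, Finset.mem_univ, true_and, Set.mem_ofPred_eq]
      exact ⟨h1.le, h1.le_succ⟩
    · ext i
      rw [hmem, h2]
  · intro μ hμ
    rw [Finset.mem_filter] at hμ
    rw [← hA _ _ (hstrip μ hμ.2) (hmem μ), hcard μ hμ.2,
      ← (isRows_rows μ).tauR_mono (Nat.sub_le (M + 1) r), ← Nat.cast_sub hr]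
    rfl

theorem tau_eq_sum_of_two_le {M : ℕ} (l : Nat.Partition (M + 1)) (h0 : 2 ≤ rows l 0) :
    tau l = ∑ r ∈ Ico 1 (M + 1), (-1 : F) ^ (r - 1) * t ^ r *
      ∑ μ : Nat.Partition (M + 1 - r),
        (if (∀ i, rows μ i ≤ rows l i) ∧ (∀ i, rows l i ≤ rows μ i + 1) then
          tau μ * psiP (M + 1) (rows l) (rows μ) else 0) := by
  have hl := isRows_rows l
  set T : Finset (Fin (M + 1)) → F := fun I =>
    (∏ i ∈ I, (-((1 - t ^ M * rowVar (rows l) i) / (1 - rowVar (rows l) i / q)))) *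
      (Matrix.vandermonde fun i : Fin (M + 1) =>
        if i ∈ I then t⁻¹ * rowVar (rows l) i else rowVar (rows l) i).det *
      (((∑ i : Fin (M + 1), rowVar (rows l) i) - ∑ i ∈ range (M + 1), (t⁻¹) ^ i) / (q - 1) -
        (∑ i ∈ I, rowVar (rows l) i) / q) with hT
  obtain ⟨C, hC⟩ : ∃ C : F, ∀ mu (I : Finset (Fin (M + 1))), IsVStrip (M + 1) (rows l) mu →
      (∀ i : Fin (M + 1), i ∈ I ↔ mu i ≠ rows l i) →
      (-1) ^ #I * t ^ #I * (tauR (M + 1) (((M + 1 : ℕ) : ℤ) - #I) mu * psiP (M + 1) (rows l) mu)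
        = C * T I :=
    ⟨_, fun mu I hmu hI => hmu.tauR_mul_psiP h0 _ I hI⟩
  have hsum : ∑ I, C * T I = 0 := by
    rw [← Finset.mul_sum]
    refine mul_eq_zero_of_right _ (sum_subsets_vandermonde_eq_zero q t q_ne_zero q_ne_one
      t_ne_zero t_ne_one (fun i : Fin (M + 1) => rowVar (rows l) i) fun i =>
        one_sub_rowVar_div_ne_zero ?_)
    by_cases hi : (i : ℕ) = 0
    · right
      rw [hi]
      omega
    · exact Or.inl hi
  have hlayer := fun (r : ℕ) (hr : r ≤ M + 1) => sum_vStrips_eq l hr (fun I => C * T I) hC (by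
    intro I hI
    have hI2 := right_ne_zero_of_mul hI
    rw [hT] at hI2
    have hI3 := left_ne_zero_of_mul hI2
    refine hl.exists_isVStrip I (fun i hi => ?_) (right_ne_zero_of_mul hI3)
    have := Finset.prod_ne_zero_iff.mp (left_ne_zero_of_mul hI3) i hi
    exact (div_ne_zero_iff.mp (neg_ne_zero.mp this)).1)
  have hempty : C * T ∅ = tau l := by
    rw [← hC (rows l) ∅ ⟨hl, hl, fun _ => le_rfl, fun _ => Nat.le_succ _⟩ (by simp), hl.psiP_self]
    simp only [Finset.card_empty, pow_zero, one_mul, mul_one, Nat.cast_zero, sub_zero]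
    rfl
  have htop : ∑ I ∈ powersetCard (M + 1) univ, C * T I = 0 := by
    rw [← hlayer (M + 1) le_rfl]
    refine mul_eq_zero_of_right _ (Finset.sum_eq_zero fun μ _ => if_neg fun hμ => ?_)
    have h1 := (isRows_rows μ).le 0
    have h2 := hμ.2 0
    omega
  rw [← Finset.powerset_univ, Finset.sum_powerset, Finset.card_univ, Fintype.card_fin,
    Finset.sum_range_succ, htop, add_zero, Finset.range_eq_Ico,
    Finset.sum_eq_sum_Ico_succ_bot (Nat.succ_pos M), Finset.powersetCard_zero,
    Finset.sum_singleton, hempty] at hsum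
  rw [eq_neg_of_add_eq_zero_left hsum, ← Finset.sum_neg_distrib]
  refine Finset.sum_congr rfl fun r hr => ?_
  obtain ⟨h1, h2⟩ := Finset.mem_Ico.mp hr
  rw [← hlayer r h2.le, ← neg_mul, ← neg_mul]
  congr 2
  obtain ⟨k, rfl⟩ : ∃ k, r = k + 1 := ⟨r - 1, by omega⟩
  rw [Nat.add_sub_cancel, pow_succ]
  ring

/-- The row lengths of the one-column partition `(1^m)`. -/
def colRows (m : ℕ) : ℕ → ℕ := fun i => if i < m then 1 else 0

theorem isRows_colRows (m : ℕ) : IsRows m (colRows m) where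
  anti i j hij := by
    simp only [colRows]
    split_ifs <;> omega
  le i := by
    simp only [colRows]
    split_ifs <;> omega
  zero := by simp [colRows]

theorem conjR_colRows {N m : ℕ} (h : m ≤ N) : conjR N (colRows m) 0 = m :=
  ((isRows_colRows m).mono h).conjR_eq fun i => by
    simp only [colRows]
    split_ifs <;> omega

theorem prod_cellsR_colRows {α : Type*} [CommMonoid α] (m : ℕ) (g : ℕ × ℕ → α) :
    ∏ s ∈ cellsR m (colRows m), g s = ∏ i ∈ range m, g (i, 0) := by
  rw [(isRows_colRows m).prod_cellsR]
  refine Finset.prod_congr rfl fun i hi => ?_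
  simp [colRows, Finset.mem_range.mp hi]

theorem sum_cellsR_colRows {α : Type*} [AddCommMonoid α] (m : ℕ) (g : ℕ × ℕ → α) :
    ∑ s ∈ cellsR m (colRows m), g s = ∑ i ∈ range m, g (i, 0) :=
  prod_cellsR_colRows (α := Multiplicative α) m g

theorem rows_eq_colRows {n : ℕ} {p : Nat.Partition n} (h : rows p 0 ≤ 1) :
    rows p = colRows n := by
  have hlen : (decParts p).length = n := by
    rw [← Multiset.coe_card, coe_decParts, parts_eq_replicate_iff.mpr h, Multiset.card_replicate]
  funext i
  have h1 := (isRows_rows p).anti (Nat.zero_le i)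
  have h2 := rows_ne_zero_iff (p := p) (i := i)
  rw [hlen] at h2
  simp only [colRows]
  split_ifs <;> omega

theorem bval_colRows {N m i : ℕ} (h : m ≤ N) (hi : i < m) :
    bval N (colRows m) (i, 0) = bRatio 0 ((m : ℤ) - 1 - i) := by
  rw [((isRows_colRows m).mono h).bval_eq (by simp [colRows, hi]), conjR_colRows h]
  simp only [colRows, hi, if_true]
  congr 1
  ring

theorem psiP_colRows {n m : ℕ} (h : m ≤ n) :
    psiP n (colRows n) (colRows m)
      = ∏ i ∈ range m, bRatio 0 ((n : ℤ) - 1 - i) / bRatio 0 ((m : ℤ) - 1 - i) := by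
  have hs : IsVStrip n (colRows n) (colRows m) := by
    refine ⟨isRows_colRows n, (isRows_colRows m).mono h, fun i => ?_, fun i => ?_⟩ <;>
    · simp only [colRows]
      split_ifs <;> omega
  rw [hs.psiP_eq_prod_cellsR, prod_cellsR_colRows]
  refine (Finset.prod_subset_one_on_sdiff (Finset.range_subset_range.mpr h) ?_ ?_).symm
  · intro i hi
    simp only [Finset.mem_sdiff, Finset.mem_range] at hi
    rw [if_neg]
    simp [colRows, hi]
  · intro i hi
    rw [Finset.mem_range] at hi
    rw [if_pos (by simp [colRows, hi, hi.trans_le h]), bval_colRows h hi,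
      bval_colRows le_rfl (hi.trans_le h)]

theorem cfun'_colRows (m : ℕ) : cfun' m (colRows m) = ∏ i ∈ range m, qtBinom 1 i := by
  rw [cfun', prod_cellsR_colRows, ← Finset.prod_range_reflect fun i : ℕ => qtBinom 1 (i : ℤ)]
  refine Finset.prod_congr rfl fun i hi => ?_
  have := Finset.mem_range.mp hi
  rw [cArm', armR, legR, conjR_colRows le_rfl]
  simp only [colRows, this, if_true, qtBinom]
  congr 3
  omega

theorem tauR_colRows {m : ℕ} (hm : 1 ≤ m) :
    tauR m m (colRows m) = (-1) ^ m * (1 - q) * ∏ i ∈ range m, bRatio 0 ((m : ℤ) - 1 - i) := by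
  obtain ⟨k, rfl⟩ : ∃ k, m = k + 1 := ⟨m - 1, by omega⟩
  have ht := t_ne_zero
  have hS : (t - 1) * (t ^ k * ∑ i ∈ range (k + 1), t⁻¹ ^ i) = t ^ (k + 1) - 1 := by
    rw [← mul_geom_sum, Finset.mul_sum, ← Finset.sum_range_reflect (fun i => t ^ i)]
    congr 1
    refine Finset.sum_congr rfl fun i hi => ?_
    have := Finset.mem_range.mp hi
    rw [inv_pow, ← div_eq_mul_inv, div_eq_iff (pow_ne_zero _ ht), ← pow_add]
    congr 1
    omega
  have hP : t ^ nstat (k + 1) (colRows (k + 1)) *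
      ∏ s ∈ (cellsR (k + 1) (colRows (k + 1))).erase (0, 0), (1 - Bbox s)
      = ∏ i ∈ range k, (t ^ (i + 1) - 1) := by
    rw [nstat, sum_cellsR_colRows, ← Finset.prod_pow_eq_pow_sum, prod_erase_eq,
      prod_cellsR_colRows, ← Finset.prod_mul_distrib, Finset.prod_range_succ']
    simp only [Prod.mk.injEq, and_true, if_true, pow_zero, mul_one]
    refine Finset.prod_congr rfl fun i _ => ?_
    rw [if_neg (Nat.succ_ne_zero i), Bbox, Nat.cast_zero, zpow_zero, one_mul, zpow_neg,
      zpow_natCast]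
    field_simp
  have hB : ∑ s ∈ cellsR (k + 1) (colRows (k + 1)), Bbox s = ∑ i ∈ range (k + 1), t⁻¹ ^ i := by
    rw [sum_cellsR_colRows]
    refine Finset.sum_congr rfl fun i _ => ?_
    simp [Bbox]
  have hR : (-1) ^ (k + 1) * ∏ i ∈ range (k + 1), bRatio 0 (((k + 1 : ℕ) : ℤ) - 1 - i)
      = (∏ i ∈ range (k + 1), (t ^ (i + 1) - 1)) / ∏ i ∈ range (k + 1), qtBinom 1 i := by
    have hneg : ∀ f : ℕ → F, (-1) ^ (k + 1) * ∏ i ∈ range (k + 1), f i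
        = ∏ i ∈ range (k + 1), -f i := fun f => by
      rw [Finset.prod_neg, Finset.card_range]
    rw [← Finset.prod_div_distrib, ← Finset.prod_range_reflect, hneg]
    refine Finset.prod_congr rfl fun i hi => ?_
    have := Finset.mem_range.mp hi
    have he : ((k + 1 : ℕ) : ℤ) - 1 - ((k + 1 - 1 - i : ℕ) : ℤ) = i := by omega
    rw [he, bRatio, zero_add, qtBinom, zpow_zero, one_mul, ← neg_div, neg_sub]
    norm_cast
  have hT : t ^ (((k + 1 : ℕ) : ℤ) - 1 + (nstat (k + 1) (colRows (k + 1)) : ℤ))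
      = t ^ k * t ^ nstat (k + 1) (colRows (k + 1)) := by
    rw [zpow_add₀ ht, Nat.cast_succ, add_sub_cancel_right, zpow_natCast, zpow_natCast]
  rw [tauR, hB, cfun'_colRows, hT]
  calc _ = (1 - q) * ((t ^ nstat (k + 1) (colRows (k + 1)) *
        ∏ s ∈ (cellsR (k + 1) (colRows (k + 1))).erase (0, 0), (1 - Bbox s)) *
        ((t - 1) * (t ^ k * ∑ i ∈ range (k + 1), t⁻¹ ^ i)) /
          ∏ i ∈ range (k + 1), qtBinom 1 i) := by ring
    _ = _ := by
      rw [hS, hP, ← Finset.prod_range_succ (fun i => t ^ (i + 1) - 1), ← hR]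
      ring

theorem tauR_mul_psiP_colRows {n m : ℕ} (hm : 1 ≤ m) (h : m ≤ n) :
    tauR m m (colRows m) * psiP n (colRows n) (colRows m)
      = (-1) ^ m * (1 - q) * ∏ i ∈ range m, bRatio 0 ((n : ℤ) - 1 - i) := by
  rw [tauR_colRows hm, psiP_colRows h, mul_assoc, ← Finset.prod_mul_distrib]
  congr 1
  refine Finset.prod_congr rfl fun i hi => ?_
  have := Finset.mem_range.mp hi
  exact mul_div_cancel₀ _ (bRatio_ne_zero le_rfl (by omega))

theorem sum_range_mul_prod_bRatio (n : ℕ) :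
    ∑ r ∈ range n, t ^ r * ((1 - q) * ∏ i ∈ range (n - r), bRatio 0 ((n : ℤ) - 1 - i))
      = 1 - t ^ n := by
  have h : ∀ r ∈ range n,
      t ^ r * ((1 - q) * ∏ i ∈ range (n - r), bRatio 0 ((n : ℤ) - 1 - i))
      = (1 - t ^ (r + 1)) * (∏ i ∈ range (n - (r + 1)), bRatio 0 ((n : ℤ) - 1 - i)) -
        (1 - t ^ r) * (∏ i ∈ range (n - r), bRatio 0 ((n : ℤ) - 1 - i)) := by
    intro r hr
    have hr' := Finset.mem_range.mp hr
    obtain ⟨k, rfl⟩ : ∃ k, n = k + (r + 1) := ⟨n - (r + 1), by omega⟩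
    have h1 : k + (r + 1) - r = k + 1 := by omega
    have h2 : ((k + (r + 1) : ℕ) : ℤ) - 1 - k = r := by
      push_cast
      ring
    have h3 : qtBinom 1 r ≠ 0 := qtBinom_ne_zero (by omega)
    have h4 : bRatio 0 r * (1 - q * t ^ r) = 1 - t ^ (r + 1) := by
      have h5 : qtBinom 1 r = 1 - q * t ^ r := by simp [qtBinom]
      rw [← h5, bRatio, zero_add, div_mul_cancel₀ _ h3, qtBinom, zpow_zero, one_mul]
      norm_cast
    rw [h1, Nat.add_sub_cancel, Finset.prod_range_succ, h2, ← h4]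
    ring
  rw [Finset.sum_congr rfl h, Finset.sum_range_sub
    (fun r => (1 - t ^ r) * ∏ i ∈ range (n - r), bRatio 0 ((n : ℤ) - 1 - i))]
  simp

theorem tau_eq_sum_of_le_one {n : ℕ} (hn : 1 ≤ n) (l : Nat.Partition n) (h0 : rows l 0 ≤ 1) :
    tau l = (∑ r ∈ Ico 1 n, (-1 : F) ^ (r - 1) * t ^ r *
      ∑ μ : Nat.Partition (n - r),
        (if (∀ i, rows μ i ≤ rows l i) ∧ (∀ i, rows l i ≤ rows μ i + 1) then
          tau μ * psiP n (rows l) (rows μ) else 0)) + (-1) ^ (n - 1) * (t ^ n - 1) := by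
  have hl := rows_eq_colRows h0
  have htau : tau l = (-1) ^ n * (1 - q) * ∏ i ∈ range n, bRatio 0 ((n : ℤ) - 1 - i) := by
    rw [← tauR_colRows hn, ← hl]
    rfl
  have hinner : ∀ r ∈ Ico 1 n, (-1 : F) ^ (r - 1) * t ^ r *
      ∑ μ : Nat.Partition (n - r),
        (if (∀ i, rows μ i ≤ rows l i) ∧ (∀ i, rows l i ≤ rows μ i + 1) then
          tau μ * psiP n (rows l) (rows μ) else 0)
      = (-1) ^ (n - 1) * (t ^ r *
        ((1 - q) * ∏ i ∈ range (n - r), bRatio 0 ((n : ℤ) - 1 - i))) := by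
    intro r hr
    obtain ⟨h1, h2⟩ := Finset.mem_Ico.mp hr
    obtain ⟨μ₀, hμ₀⟩ := (isRows_colRows (n - r)).exists_partition (m := n - r) (by
      rw [Finset.sum_congr rfl fun i hi => show colRows (n - r) i = 1 from
        if_pos (Finset.mem_range.mp hi)]
      simp)
    have hμ₀0 : (∀ i, rows μ₀ i ≤ rows l i) ∧ (∀ i, rows l i ≤ rows μ₀ i + 1) := by
      rw [hμ₀, hl]
      constructor <;> intro i <;> simp only [colRows] <;> split_ifs <;> omega
    rw [Finset.sum_eq_single μ₀, if_pos hμ₀0]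
    · have h3 := tauR_mul_psiP_colRows (n := n) (m := n - r) (by omega) (Nat.sub_le _ _)
      have h4 : tau μ₀ = tauR (n - r) ((n - r : ℕ) : ℤ) (colRows (n - r)) := by
        rw [← hμ₀]
        rfl
      have h5 : (-1 : F) ^ (n - 1) = (-1) ^ (r - 1) * (-1) ^ (n - r) := by
        rw [← pow_add]
        congr 1
        omega
      rw [h4, hμ₀, hl, h3, h5]
      ring
    · intro μ _ hne
      refine if_neg fun hμ => hne (rows_injective ?_)
      rw [hμ₀, rows_eq_colRows ((hμ.1 0).trans h0)]
    · intro h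
      exact absurd (Finset.mem_univ _) h
  rw [Finset.sum_congr rfl hinner, ← Finset.mul_sum, htau]
  have hsum := sum_range_mul_prod_bRatio n
  rw [Finset.range_eq_Ico, Finset.sum_eq_sum_Ico_succ_bot hn] at hsum
  simp only [pow_zero, one_mul, Nat.sub_zero, zero_add] at hsum
  obtain ⟨k, rfl⟩ : ∃ k, n = k + 1 := ⟨n - 1, by omega⟩
  rw [Nat.add_sub_cancel, pow_succ (-1 : F) k]
  linear_combination (-(-1) ^ k) * hsum

end

/-- For a partition `λ` of `n ≥ 1`, `τ` satisfies the recursion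
`τ_λ = ∑_{r=1}^{n−1} (−1)^{r−1} t^r ∑_μ τ_μ ψ'_{λ/μ}(q,t)
        + δ_{λ,(1^n)} (−1)^{n−1}(t^n − 1)`,
the inner sum being over partitions `μ ⊆ λ` with `|μ| = n−r` such that `λ/μ` is a
vertical strip. -/
theorem stmt17 (n : ℕ) (hn : 1 ≤ n) (l : Nat.Partition n) :
    tau l
    = (∑ r ∈ Finset.Ico 1 n, (-1 : F) ^ (r - 1) * t ^ r *
        ∑ μ : Nat.Partition (n - r),
          (if (∀ i, rows μ i ≤ rows l i) ∧ (∀ i, rows l i ≤ rows μ i + 1) then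
            tau μ * psiP n (rows l) (rows μ)
          else 0)) +
      (if l.parts = Multiset.replicate n 1 then 1 else 0) *
        ((-1 : F) ^ (n - 1) * (t ^ n - 1)) := by
  by_cases h0 : rows l 0 ≤ 1
  · rw [if_pos (parts_eq_replicate_iff.mpr h0), one_mul]
    exact tau_eq_sum_of_le_one hn l h0
  · rw [if_neg (mt parts_eq_replicate_iff.mp h0), zero_mul, add_zero]
    obtain ⟨M, rfl⟩ : ∃ M, n = M + 1 := ⟨n - 1, by omega⟩
    exact tau_eq_sum_of_two_le l (by omega)
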